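/- arXiv:2306.04770 — 17 statements merged into one kernel-verified Lean document; each statement's English description precedes it below -/
import Mathlib

section
/- The Z3-symmetric down-up algebra A(0,0,0) over F has a basis consisting of the products of standard generators X_1 X_2 ... X_n (with n a natural number, each X_i one of A, B, C, and the empty product equal to 1) such that for 1 <= i <= n-2 the triple (X_i, X_{i+1}, X_{i+2}) is not one of (B,A,A), (B,B,A), (C,B,B), (C,C,B), (A,C,C), (A,A,C). -/
noncomputable section

/-- The generators of the free algebra on three generators. -/
abbrev XX (F : Type*) [Field F] (i : Fin 3) : FreeAlgebra F (Fin 3) := FreeAlgebra.ι F i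

/-- The defining relations of the Z3-symmetric down-up algebra. -/
inductive DURel (F : Type*) [Field F] (α β γ : F) :
    FreeAlgebra F (Fin 3) → FreeAlgebra F (Fin 3) → Prop
  | r1 : DURel F α β γ (XX F 1 * XX F 0 ^ 2)
      (α • (XX F 0 * XX F 1 * XX F 0) + β • (XX F 0 ^ 2 * XX F 1) + γ • XX F 0)
  | r2 : DURel F α β γ (XX F 1 ^ 2 * XX F 0)
      (α • (XX F 1 * XX F 0 * XX F 1) + β • (XX F 0 * XX F 1 ^ 2) + γ • XX F 1)
  | r3 : DURel F α β γ (XX F 2 * XX F 1 ^ 2)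
      (α • (XX F 1 * XX F 2 * XX F 1) + β • (XX F 1 ^ 2 * XX F 2) + γ • XX F 1)
  | r4 : DURel F α β γ (XX F 2 ^ 2 * XX F 1)
      (α • (XX F 2 * XX F 1 * XX F 2) + β • (XX F 1 * XX F 2 ^ 2) + γ • XX F 2)
  | r5 : DURel F α β γ (XX F 0 * XX F 2 ^ 2)
      (α • (XX F 2 * XX F 0 * XX F 2) + β • (XX F 2 ^ 2 * XX F 0) + γ • XX F 2)
  | r6 : DURel F α β γ (XX F 0 ^ 2 * XX F 2)
      (α • (XX F 0 * XX F 2 * XX F 0) + β • (XX F 2 * XX F 0 ^ 2) + γ • XX F 0)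

/-- The Z3-symmetric down-up algebra `𝔸(α,β,γ)`: with generators `A = 0`, `B = 1`, `C = 2`. -/
abbrev DU (F : Type*) [Field F] (α β γ : F) := RingQuot (DURel F α β γ)

/-- The standard generators `A, B, C` of the Z3-symmetric down-up algebra. -/
def DUgen (F : Type*) [Field F] (α β γ : F) (i : Fin 3) : DU F α β γ :=
  RingQuot.mkAlgHom F (DURel F α β γ) (XX F i)

/-- The product of standard generators indexed by a word (empty product is `1`). -/
def wordProd (F : Type*) [Field F] (α β γ : F) (w : List (Fin 3)) : DU F α β γ :=
  (w.map (DUgen F α β γ)).prod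

/-- The six forbidden consecutive triples (with `A = 0`, `B = 1`, `C = 2`):
`(B,A,A), (B,B,A), (C,B,B), (C,C,B), (A,C,C), (A,A,C)`. -/
def Forbidden : Set (List (Fin 3)) :=
  {[1, 0, 0], [1, 1, 0], [2, 1, 1], [2, 2, 1], [0, 2, 2], [0, 0, 2]}

/-- A word is admissible when no forbidden triple occurs at consecutive positions. -/
def Admissible (w : List (Fin 3)) : Prop := ∀ u ∈ Forbidden, ¬ u <:+: w

open Classical in
/-- Left multiplication by a generator on the space of words, in which the words that are not
admissible are set to zero. -/
def consOp (F : Type*) [Field F] (i : Fin 3) : Module.End F (List (Fin 3) →₀ F) :=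
  Finsupp.linearCombination F fun w => if Admissible (i :: w) then Finsupp.single (i :: w) 1 else 0

lemma consOp_of_admissible (F : Type*) [Field F] {i : Fin 3} {w : List (Fin 3)}
    (h : Admissible (i :: w)) :
    consOp F i (Finsupp.single w 1) = Finsupp.single (i :: w) 1 := by
  simp [consOp, h]

lemma consOp_of_not_admissible (F : Type*) [Field F] {i : Fin 3} {w : List (Fin 3)}
    (h : ¬ Admissible (i :: w)) :
    consOp F i (Finsupp.single w 1) = 0 := by
  simp [consOp, h]

lemma Admissible.of_cons {i : Fin 3} {w : List (Fin 3)} (h : Admissible (i :: w)) :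
    Admissible w :=
  fun u hu hw => h u hu (hw.trans (List.suffix_cons i w).isInfix)

lemma consOp_mul_mul_eq_zero (F : Type*) [Field F] {i j k : Fin 3} (h : [i, j, k] ∈ Forbidden) :
    consOp F i * consOp F j * consOp F k = 0 := by
  refine Finsupp.lhom_ext' fun w => LinearMap.ext_ring ?_
  simp only [LinearMap.comp_apply, Finsupp.lsingle_apply, Module.End.mul_apply,
    LinearMap.zero_apply]
  by_cases hk : Admissible (k :: w)
  · rw [consOp_of_admissible F hk]
    by_cases hj : Admissible (j :: k :: w)
    · rw [consOp_of_admissible F hj]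
      exact consOp_of_not_admissible F fun hi => hi _ h (List.prefix_append [i, j, k] w).isInfix
    · rw [consOp_of_not_admissible F hj, map_zero]
  · rw [consOp_of_not_admissible F hk, map_zero, map_zero]

/-- The action of `𝔸(0,0,0)` on the space of words. -/
def wordRep (F : Type*) [Field F] : DU F 0 0 0 →ₐ[F] Module.End F (List (Fin 3) →₀ F) :=
  RingQuot.liftAlgHom F ⟨FreeAlgebra.lift F (consOp F), by
    rintro _ _ (_ | _ | _ | _ | _ | _) <;>
    simp only [XX, map_mul, FreeAlgebra.lift_ι_apply, zero_smul,
      add_zero, pow_two, ← mul_assoc] <;>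
    refine (consOp_mul_mul_eq_zero F ?_).trans (map_zero _).symm <;>
    simp [Forbidden]⟩

lemma wordRep_gen (F : Type*) [Field F] (i : Fin 3) :
    wordRep F (DUgen F 0 0 0 i) = consOp F i := by
  simp [wordRep, DUgen]

lemma wordProd_cons (F : Type*) [Field F] (α β γ : F) (i : Fin 3) (w : List (Fin 3)) :
    wordProd F α β γ (i :: w) = DUgen F α β γ i * wordProd F α β γ w := by
  simp [wordProd]

lemma wordProd_append (F : Type*) [Field F] (α β γ : F) (v w : List (Fin 3)) :
    wordProd F α β γ (v ++ w) = wordProd F α β γ v * wordProd F α β γ w := by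
  simp [wordProd]

lemma wordRep_wordProd (F : Type*) [Field F] {w : List (Fin 3)} (h : Admissible w) :
    wordRep F (wordProd F 0 0 0 w) (Finsupp.single [] 1) = Finsupp.single w 1 := by
  induction w with
  | nil => simp [wordProd]
  | cons i w ih =>
    rw [wordProd_cons, map_mul, Module.End.mul_apply, ih h.of_cons, wordRep_gen,
      consOp_of_admissible F h]

lemma wordProd_forbidden (F : Type*) [Field F] {u : List (Fin 3)} (h : u ∈ Forbidden) :
    wordProd F 0 0 0 u = 0 := by
  have key : ∀ {x y : FreeAlgebra F (Fin 3)}, DURel F 0 0 0 x y →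
      RingQuot.mkAlgHom F (DURel F 0 0 0) x = RingQuot.mkAlgHom F (DURel F 0 0 0) y :=
    fun h => RingQuot.mkAlgHom_rel F h
  have h₁ := key .r1
  have h₂ := key .r2
  have h₃ := key .r3
  have h₄ := key .r4
  have h₅ := key .r5
  have h₆ := key .r6
  simp only [map_mul, zero_smul, add_zero, map_zero, pow_two] at h₁ h₂ h₃ h₄ h₅ h₆
  simp only [mul_assoc] at h₁ h₂ h₃ h₄ h₅ h₆
  rcases h with rfl | rfl | rfl | rfl | rfl | rfl <;>
  simpa only [wordProd, DUgen, List.map_cons, List.map_nil, List.prod_cons, List.prod_nil, mul_one]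

lemma wordProd_of_not_admissible (F : Type*) [Field F] {w : List (Fin 3)} (h : ¬ Admissible w) :
    wordProd F 0 0 0 w = 0 := by
  simp only [Admissible, not_forall, not_not] at h
  obtain ⟨u, hu, s, t, rfl⟩ := h
  rw [wordProd_append, wordProd_append, wordProd_forbidden F hu, mul_zero, zero_mul]

lemma span_range_wordProd (F : Type*) [Field F] (α β γ : F) :
    Submodule.span F (Set.range (wordProd F α β γ)) = ⊤ := by
  have hgen : Algebra.adjoin F (Set.range (DUgen F α β γ)) = ⊤ := by
    have : Set.range (DUgen F α β γ) =
        RingQuot.mkAlgHom F (DURel F α β γ) '' Set.range (FreeAlgebra.ι F) :=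
      Set.range_comp (RingQuot.mkAlgHom F (DURel F α β γ)) (FreeAlgebra.ι F)
    rw [this, ← AlgHom.map_adjoin, FreeAlgebra.adjoin_range_ι, Algebra.map_top,
      AlgHom.range_eq_top]
    exact RingQuot.mkAlgHom_surjective F _
  rw [eq_top_iff, ← Algebra.top_toSubmodule, ← hgen, Algebra.adjoin_eq_span]
  refine Submodule.span_mono fun x hx => ?_
  induction hx using Submonoid.closure_induction with
  | mem x hx =>
    obtain ⟨i, rfl⟩ := hx
    exact ⟨[i], by simp [wordProd]⟩
  | one => exact ⟨[], by simp [wordProd]⟩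
  | mul x y _ _ hx hy =>
    obtain ⟨v, rfl⟩ := hx
    obtain ⟨w, rfl⟩ := hy
    exact ⟨v ++ w, wordProd_append F α β γ v w⟩

/-- the products of standard generators along admissible words form a basis of
the Z3-symmetric down-up algebra `𝔸(0,0,0)`. -/
theorem stmt0 (F : Type*) [Field F] [IsAlgClosed F] [CharZero F] :
    LinearIndependent F
        (fun w : {w : List (Fin 3) // Admissible w} => wordProd F 0 0 0 w.1) ∧
      Submodule.span F
        (Set.range fun w : {w : List (Fin 3) // Admissible w} => wordProd F 0 0 0 w.1) = ⊤ := by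
  constructor
  · refine LinearIndependent.of_comp
      ((LinearMap.applyₗ (Finsupp.single [] 1)).comp (wordRep F).toLinearMap) ?_
    have : (((LinearMap.applyₗ (Finsupp.single [] 1)).comp (wordRep F).toLinearMap) ∘
        fun w : {w : List (Fin 3) // Admissible w} => wordProd F 0 0 0 w.1) =
        (fun w => Finsupp.single w (1 : F)) ∘ Subtype.val :=
      funext fun w => wordRep_wordProd F w.2
    rw [this]
    exact (Finsupp.linearIndependent_single_one F _).comp _ Subtype.val_injective
  · rw [eq_top_iff, ← span_range_wordProd F 0 0 0, Submodule.span_le]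
    rintro _ ⟨w, rfl⟩
    by_cases h : Admissible w
    · exact Submodule.subset_span ⟨⟨w, h⟩, rfl⟩
    · rw [wordProd_of_not_admissible F h]
      exact Submodule.zero_mem _
end
end

section
/- For every nonzero gamma in F, there exists an algebra isomorphism from the Z3-symmetric down-up algebra A(0,0,gamma) to S(gamma) sending A to D, B to D, and C to D. In particular, in A(0,0,gamma) one has A = B = C and A^3 = gamma*A, and A(0,0,gamma) has dimension 3 over F. -/
noncomputable section

/-- The defining relation `D^3 = γ • D` of the algebra `S(γ)`. -/
inductive SRel (F : Type*) [Field F] (γ : F) :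
    FreeAlgebra F Unit → FreeAlgebra F Unit → Prop
  | r : SRel F γ (FreeAlgebra.ι F () ^ 3) (γ • FreeAlgebra.ι F ())

/-- The algebra `S(γ)` with one generator `D` and one relation `D^3 = γ D`. -/
abbrev SAlg (F : Type*) [Field F] (γ : F) := RingQuot (SRel F γ)

/-- The generator `D` of `S(γ)`. -/
def Dgen (F : Type*) [Field F] (γ : F) : SAlg F γ :=
  RingQuot.mkAlgHom F (SRel F γ) (FreeAlgebra.ι F ())

theorem Dgen_pow_three (F : Type*) [Field F] (γ : F) : Dgen F γ ^ 3 = γ • Dgen F γ := by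
  simpa [Dgen] using RingQuot.mkAlgHom_rel F (SRel.r (F := F) (γ := γ))

open Polynomial in
/-- The homomorphism `F[X] / (X ^ 3 - γ X) → S(γ)` sending the root to `D`. -/
def SAlg.ofAdjoinRoot (F : Type*) [Field F] (γ : F) :
    AdjoinRoot (X ^ 3 - C γ * X : F[X]) →ₐ[F] SAlg F γ :=
  Ideal.Quotient.liftₐ (Ideal.span {X ^ 3 - C γ * X}) (aeval (Dgen F γ)) fun p hp => by
    obtain ⟨q, rfl⟩ := Ideal.mem_span_singleton.mp hp
    have h : aeval (Dgen F γ) (X ^ 3 - C γ * X) = 0 := by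
      simp [Dgen_pow_three, Algebra.smul_def]
    rw [map_mul, h, zero_mul]

open Polynomial in
@[simp]
theorem SAlg.ofAdjoinRoot_root (F : Type*) [Field F] (γ : F) :
    SAlg.ofAdjoinRoot F γ (AdjoinRoot.root (X ^ 3 - C γ * X)) = Dgen F γ :=
  aeval_X (R := F) (Dgen F γ)

open Polynomial in
/-- `S(γ)` is the quotient of `F[X]` by `X ^ 3 - γ X`. -/
def SAlg.equivAdjoinRoot (F : Type*) [Field F] (γ : F) :
    SAlg F γ ≃ₐ[F] AdjoinRoot (X ^ 3 - C γ * X : F[X]) :=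
  AlgEquiv.ofAlgHom
    (RingQuot.liftAlgHom F ⟨FreeAlgebra.lift F fun _ => AdjoinRoot.root (X ^ 3 - C γ * X), by
      rintro _ _ ⟨⟩
      have h := AdjoinRoot.eval₂_root (X ^ 3 - C γ * X : F[X])
      simp only [eval₂_sub, eval₂_mul, eval₂_pow, eval₂_X, eval₂_C, sub_eq_zero] at h
      simpa [Algebra.smul_def] using h⟩)
    (SAlg.ofAdjoinRoot F γ)
    (by ext; simp [Dgen])
    (by ext; simp [Dgen])

open Polynomial in
theorem SAlg.finrank_eq (F : Type*) [Field F] (γ : F) : Module.finrank F (SAlg F γ) = 3 := by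
  have hd : (X ^ 3 - C γ * X : F[X]).natDegree = 3 := by compute_degree!
  have h0 : (X ^ 3 - C γ * X : F[X]) ≠ 0 := ne_zero_of_natDegree_gt (n := 0) (by omega)
  rw [(SAlg.equivAdjoinRoot F γ).toLinearEquiv.finrank_eq,
    (AdjoinRoot.powerBasis h0).finrank, AdjoinRoot.powerBasis_dim, hd]

section Relations

variable {F R : Type*} [Field F] [Ring R] [Algebra F R] {γ : F} {a b c : R}

theorem mul_eq_mul_of_downUp (hγ : γ ≠ 0) (h₁ : b ^ 2 * a = γ • b) (h₂ : c * b ^ 2 = γ • b) :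
    b * a = c * b := by
  have h : c * b ^ 2 * a = c * (b ^ 2 * a) := mul_assoc _ _ _
  rw [h₁, h₂, smul_mul_assoc, mul_smul_comm] at h
  exact smul_right_injective R hγ h

theorem eq_of_downUp (hγ : γ ≠ 0) (h₁ : b * a ^ 2 = γ • a) (h₂ : c ^ 2 * b = γ • c)
    (h : b * a = c * b) : a = c := by
  refine smul_right_injective R hγ ?_
  calc γ • a = b * a * a := by rw [← h₁, pow_two, mul_assoc]
    _ = c * (c * b) := by rw [h, mul_assoc, h]
    _ = γ • c := by rw [← h₂, pow_two, mul_assoc]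

end Relations

theorem DUgen_rel {F : Type*} [Field F] {γ : F} {x y : FreeAlgebra F (Fin 3)}
    (h : DURel F 0 0 γ x y) :
    FreeAlgebra.lift F (DUgen F 0 0 γ) x = FreeAlgebra.lift F (DUgen F 0 0 γ) y := by
  have hl : FreeAlgebra.lift F (DUgen F 0 0 γ) = RingQuot.mkAlgHom F (DURel F 0 0 γ) := by
    ext; simp [DUgen]
  rw [hl]
  exact RingQuot.mkAlgHom_rel F h

theorem DUgen_zero_eq_two {F : Type*} [Field F] {γ : F} (hγ : γ ≠ 0) :
    DUgen F 0 0 γ 0 = DUgen F 0 0 γ 2 :=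
  eq_of_downUp hγ (by simpa using DUgen_rel (.r1 (γ := γ)))
    (by simpa using DUgen_rel (.r4 (γ := γ)))
    (mul_eq_mul_of_downUp hγ (by simpa using DUgen_rel (.r2 (γ := γ)))
      (by simpa using DUgen_rel (.r3 (γ := γ))))

theorem DUgen_one_eq_zero {F : Type*} [Field F] {γ : F} (hγ : γ ≠ 0) :
    DUgen F 0 0 γ 1 = DUgen F 0 0 γ 0 :=
  eq_of_downUp hγ (by simpa using DUgen_rel (.r3 (γ := γ)))
    (by simpa using DUgen_rel (.r6 (γ := γ)))
    (mul_eq_mul_of_downUp hγ (by simpa using DUgen_rel (.r4 (γ := γ)))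
      (by simpa using DUgen_rel (.r5 (γ := γ))))

theorem DUgen_zero_pow_three {F : Type*} [Field F] {γ : F} (hγ : γ ≠ 0) :
    DUgen F 0 0 γ 0 ^ 3 = γ • DUgen F 0 0 γ 0 := by
  have h : DUgen F 0 0 γ 1 * DUgen F 0 0 γ 0 ^ 2 = γ • DUgen F 0 0 γ 0 := by
    simpa using DUgen_rel (.r1 (γ := γ))
  rwa [DUgen_one_eq_zero hγ, ← pow_succ'] at h

theorem DUgen_eq_zero {F : Type*} [Field F] {γ : F} (hγ : γ ≠ 0) (i : Fin 3) :
    DUgen F 0 0 γ i = DUgen F 0 0 γ 0 := by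
  fin_cases i
  exacts [rfl, DUgen_one_eq_zero hγ, (DUgen_zero_eq_two hγ).symm]

/-- For nonzero `γ`, the isomorphism `𝔸(0,0,γ) ≅ S(γ)` sending every generator to `D`. -/
def DU.equivSAlg {F : Type*} [Field F] {γ : F} (hγ : γ ≠ 0) : DU F 0 0 γ ≃ₐ[F] SAlg F γ :=
  AlgEquiv.ofAlgHom
    (RingQuot.liftAlgHom F ⟨FreeAlgebra.lift F fun _ => Dgen F γ, by
      rintro _ _ ⟨⟩ <;> simp [← pow_succ, ← pow_succ', Dgen_pow_three]⟩)
    (RingQuot.liftAlgHom F ⟨FreeAlgebra.lift F fun _ => DUgen F 0 0 γ 0, by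
      rintro _ _ ⟨⟩
      simpa using DUgen_zero_pow_three hγ⟩)
    (by ext; simp [Dgen, DUgen])
    (by
      ext i
      simpa [Dgen, DUgen] using (DUgen_eq_zero hγ i).symm)

theorem DU.equivSAlg_DUgen {F : Type*} [Field F] {γ : F} (hγ : γ ≠ 0) (i : Fin 3) :
    DU.equivSAlg hγ (DUgen F 0 0 γ i) = Dgen F γ := by
  simp [DU.equivSAlg, DUgen]

/-- for nonzero `γ`, there is an algebra isomorphism `𝔸(0,0,γ) ≅ S(γ)` sending
`A ↦ D`, `B ↦ D`, `C ↦ D`; in particular `A = B = C`, `A^3 = γ A`, and `𝔸(0,0,γ)` has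
dimension `3` over `F`. -/
theorem stmt1 (F : Type*) [Field F] [IsAlgClosed F] [CharZero F] (γ : F) (hγ : γ ≠ 0) :
    (∃ e : DU F 0 0 γ ≃ₐ[F] SAlg F γ,
        e (DUgen F 0 0 γ 0) = Dgen F γ ∧
        e (DUgen F 0 0 γ 1) = Dgen F γ ∧
        e (DUgen F 0 0 γ 2) = Dgen F γ) ∧
      DUgen F 0 0 γ 0 = DUgen F 0 0 γ 1 ∧
      DUgen F 0 0 γ 1 = DUgen F 0 0 γ 2 ∧
      DUgen F 0 0 γ 0 ^ 3 = γ • DUgen F 0 0 γ 0 ∧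
      Module.finrank F (DU F 0 0 γ) = 3 := by
  exact ⟨⟨DU.equivSAlg hγ, DU.equivSAlg_DUgen hγ 0, DU.equivSAlg_DUgen hγ 1,
      DU.equivSAlg_DUgen hγ 2⟩,
    (DUgen_one_eq_zero hγ).symm, (DUgen_one_eq_zero hγ).trans (DUgen_zero_eq_two hγ),
    DUgen_zero_pow_three hγ,
    (DU.equivSAlg hγ).toLinearEquiv.finrank_eq.trans (SAlg.finrank_eq F γ)⟩
end
end

section
/- Assume gamma = 0. Then the algebra homomorphism from the down-up algebra 𝒜(alpha,beta,0) to the Z3-symmetric down-up algebra A(alpha,beta,0) that sends A to A and B to B is injective. -/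
noncomputable section

/-- Generators of the free algebra on two generators. -/
abbrev YY (F : Type*) [Field F] (i : Fin 2) : FreeAlgebra F (Fin 2) := FreeAlgebra.ι F i

/-- The defining relations of the (two-generator) down-up algebra of Benkart and Roby. -/
inductive DU2Rel (F : Type*) [Field F] (α β γ : F) :
    FreeAlgebra F (Fin 2) → FreeAlgebra F (Fin 2) → Prop
  | r1 : DU2Rel F α β γ (YY F 1 * YY F 0 ^ 2)
      (α • (YY F 0 * YY F 1 * YY F 0) + β • (YY F 0 ^ 2 * YY F 1) + γ • YY F 0)
  | r2 : DU2Rel F α β γ (YY F 1 ^ 2 * YY F 0)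
      (α • (YY F 1 * YY F 0 * YY F 1) + β • (YY F 0 * YY F 1 ^ 2) + γ • YY F 1)

/-- The down-up algebra `𝒜(α,β,γ)` with generators `A = 0`, `B = 1`. -/
abbrev DU2 (F : Type*) [Field F] (α β γ : F) := RingQuot (DU2Rel F α β γ)

/-- The standard generators `A, B` of the down-up algebra. -/
def DU2gen (F : Type*) [Field F] (α β γ : F) (i : Fin 2) : DU2 F α β γ :=
  RingQuot.mkAlgHom F (DU2Rel F α β γ) (YY F i)

/-- The homomorphism `𝒜(α,β,γ) → 𝔸(α,β,γ)` sending `A ↦ A`, `B ↦ B`. -/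
def DU2.toDU (F : Type*) [Field F] (α β γ : F) : DU2 F α β γ →ₐ[F] DU F α β γ :=
  RingQuot.liftAlgHom F ⟨FreeAlgebra.lift F ![DUgen F α β γ 0, DUgen F α β γ 1], by
    intro x y h
    cases h with
    | r1 => simpa [DUgen] using RingQuot.mkAlgHom_rel F (DURel.r1 (α := α) (β := β) (γ := γ))
    | r2 => simpa [DUgen] using RingQuot.mkAlgHom_rel F (DURel.r2 (α := α) (β := β) (γ := γ))⟩

/-- The homomorphism `𝔸(α,β,0) → 𝒜(α,β,0)` sending `A ↦ A`, `B ↦ B`, `C ↦ 0`. -/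
def DU.toDU2 (F : Type*) [Field F] (α β : F) : DU F α β 0 →ₐ[F] DU2 F α β 0 :=
  RingQuot.liftAlgHom F ⟨FreeAlgebra.lift F ![DU2gen F α β 0 0, DU2gen F α β 0 1, 0], by
    intro x y h
    cases h with
    | r1 => simpa [DU2gen] using RingQuot.mkAlgHom_rel F (DU2Rel.r1 (α := α) (β := β) (γ := 0))
    | r2 => simpa [DU2gen] using RingQuot.mkAlgHom_rel F (DU2Rel.r2 (α := α) (β := β) (γ := 0))
    | _ => simp⟩

theorem DU2.toDU_gen_zero (F : Type*) [Field F] (α β γ : F) :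
    DU2.toDU F α β γ (DU2gen F α β γ 0) = DUgen F α β γ 0 := by
  simp [DU2.toDU, DU2gen]

theorem DU2.toDU_gen_one (F : Type*) [Field F] (α β γ : F) :
    DU2.toDU F α β γ (DU2gen F α β γ 1) = DUgen F α β γ 1 := by
  simp [DU2.toDU, DU2gen]

theorem DU.toDU2_comp_toDU (F : Type*) [Field F] (α β : F) :
    (DU.toDU2 F α β).comp (DU2.toDU F α β 0) = AlgHom.id F (DU2 F α β 0) := by
  apply RingQuot.ringQuot_ext'
  ext i
  fin_cases i <;> simp [DU2.toDU, DU.toDU2, DUgen, DU2gen]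

/-- when `γ = 0`, the natural algebra homomorphism
`𝒜(α,β,0) → 𝔸(α,β,0)`, `A ↦ A`, `B ↦ B`, is injective. -/
theorem stmt2 (F : Type*) [Field F] [IsAlgClosed F] [CharZero F] (α β : F) :
    ∃ f : DU2 F α β 0 →ₐ[F] DU F α β 0,
      f (DU2gen F α β 0 0) = DUgen F α β 0 0 ∧
      f (DU2gen F α β 0 1) = DUgen F α β 0 1 ∧
      Function.Injective f := by
  refine ⟨DU2.toDU F α β 0, DU2.toDU_gen_zero F α β 0, DU2.toDU_gen_one F α β 0, ?_⟩
  exact Function.LeftInverse.injective (g := DU.toDU2 F α β)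
    (DFunLike.congr_fun (DU.toDU2_comp_toDU F α β))
end
end

section
/- Assume alpha is nonzero. Then there exists an algebra homomorphism from the Z3-symmetric down-up algebra A(alpha,beta,gamma) to the algebra of 3x3 matrices over the Laurent polynomial ring F[t,t^{-1}] sending A to the matrix with (1,2)-entry t and (3,2)-entry -gamma/(alpha*t) and all other entries 0; B to the matrix with (1,3)-entry -gamma/(alpha*t) and (2,3)-entry t and all other entries 0; and C to the matrix with (2,1)-entry -gamma/(alpha*t) and (3,1)-entry t and all other entries 0. -/
noncomputable section

/-- If `α s t = -γ` in a commutative `F`-algebra `R`, the matrices `t E₁₂ + s E₃₂`,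
`s E₁₃ + t E₂₃`, `s E₂₁ + t E₃₁` are the images of the generators under a homomorphism
from the `Z3`-symmetric down-up algebra to the `3×3` matrices over `R`. -/
theorem exists_algHom_matrix {F R : Type*} [Field F] [CommRing R] [Algebra F R] {α γ : F} (β : F)
    {s t : R} (h : algebraMap F R α * (s * t) = -algebraMap F R γ) :
    ∃ f : DU F α β γ →ₐ[F] Matrix (Fin 3) (Fin 3) R,
      f (DUgen F α β γ 0) = !![0, t, 0; 0, 0, 0; 0, s, 0] ∧
      f (DUgen F α β γ 1) = !![0, 0, s; 0, 0, t; 0, 0, 0] ∧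
      f (DUgen F α β γ 2) = !![0, 0, 0; s, 0, 0; t, 0, 0] := by
  let M : Fin 3 → Matrix (Fin 3) (Fin 3) R :=
    ![!![0, t, 0; 0, 0, 0; 0, s, 0], !![0, 0, s; 0, 0, t; 0, 0, 0], !![0, 0, 0; s, 0, 0; t, 0, 0]]
  have hsq (i : Fin 3) : M i ^ 2 = 0 := by
    fin_cases i <;> ext j k <;> fin_cases j <;> fin_cases k <;>
      simp [M, pow_two, Matrix.mul_apply, Fin.sum_univ_three]
  have hmul (i j : Fin 3) (hij : i ≠ j) : M i * M j * M i = (s * t) • M i := by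
    fin_cases i <;> fin_cases j <;> first | exact absurd rfl hij | skip
    all_goals
      ext k l
      fin_cases k <;> fin_cases l <;>
        simp [M, Matrix.mul_apply, Fin.sum_univ_three] <;> ring
  have hzero (i j : Fin 3) (hij : i ≠ j) : α • (M i * M j * M i) + γ • M i = 0 := by
    rw [hmul i j hij, ← algebraMap_smul R α, ← algebraMap_smul R γ, smul_smul, ← add_smul, h,
      neg_add_cancel, zero_smul]
  have hM : ∀ ⦃x y⦄, DURel F α β γ x y →
      FreeAlgebra.lift F M x = FreeAlgebra.lift F M y := by
    intro x y hxy
    cases hxy <;> simp [hsq, hzero]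
  refine ⟨RingQuot.liftAlgHom F ⟨FreeAlgebra.lift F M, hM⟩, ?_, ?_, ?_⟩ <;>
    simp [DUgen, XX, M]

open LaurentPolynomial in
/-- for `α ≠ 0`, an algebra homomorphism from `𝔸(α,β,γ)` to the `3×3` matrices
over the Laurent polynomial ring `F[t,t⁻¹]`, with the indicated images of `A`, `B`, `C`. -/
theorem stmt3 (F : Type*) [Field F] [IsAlgClosed F] [CharZero F] (α β γ : F) (hα : α ≠ 0) :
    ∃ f : DU F α β γ →ₐ[F] Matrix (Fin 3) (Fin 3) (LaurentPolynomial F),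
      f (DUgen F α β γ 0) =
        !![0, T 1, 0;
           0, 0, 0;
           0, -(LaurentPolynomial.C (γ / α) * T (-1)), 0] ∧
      f (DUgen F α β γ 1) =
        !![0, 0, -(LaurentPolynomial.C (γ / α) * T (-1));
           0, 0, T 1;
           0, 0, 0] ∧
      f (DUgen F α β γ 2) =
        !![0, 0, 0;
           -(LaurentPolynomial.C (γ / α) * T (-1)), 0, 0;
           T 1, 0, 0] := by
  refine exists_algHom_matrix β ?_
  have hT : (T (-1) * T 1 : LaurentPolynomial F) = 1 := by rw [← T_add]; simp
  have hC : LaurentPolynomial.C α * LaurentPolynomial.C (γ / α) = LaurentPolynomial.C γ := by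
    rw [← map_mul, mul_div_cancel₀ _ hα]
  simp only [LaurentPolynomial.algebraMap_apply, Algebra.algebraMap_self,
    RingHom.id_apply]
  linear_combination (-LaurentPolynomial.C α * LaurentPolynomial.C (γ / α)) * hT - hC
end
end

section
/- Pick theta, xi in F and consider the Z3-symmetric down-up algebra A(xi+1, -xi, (xi-1)*theta). There exists an algebra homomorphism from A(xi+1, -xi, (xi-1)*theta) to the Weyl algebra W(theta) that sends A to A, B to B, and C to -A-B. In particular, the elements A, B, C := -A-B of W(theta) satisfy the Z3-symmetric down-up relations with parameters alpha = xi+1, beta = -xi, gamma = (xi-1)*theta. -/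
noncomputable section

/-- Elements `A, B, C` of an `F`-algebra satisfy the Z3-symmetric down-up relations with
parameters `α, β, γ`. -/
def SatisfiesDU {F : Type*} [Field F] {T : Type*} [Ring T] [Algebra F T]
    (α β γ : F) (A B C : T) : Prop :=
  B * A ^ 2 = α • (A * B * A) + β • (A ^ 2 * B) + γ • A ∧
  B ^ 2 * A = α • (B * A * B) + β • (A * B ^ 2) + γ • B ∧
  C * B ^ 2 = α • (B * C * B) + β • (B ^ 2 * C) + γ • B ∧
  C ^ 2 * B = α • (C * B * C) + β • (B * C ^ 2) + γ • C ∧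
  A * C ^ 2 = α • (C * A * C) + β • (C ^ 2 * A) + γ • C ∧
  A ^ 2 * C = α • (A * C * A) + β • (C * A ^ 2) + γ • A

/-- The defining relation `AB - BA = θ` of the Weyl algebra, with `A = 0`, `B = 1`. -/
inductive WeylRel (F : Type*) [Field F] (θ : F) :
    FreeAlgebra F (Fin 2) → FreeAlgebra F (Fin 2) → Prop
  | r : WeylRel F θ (FreeAlgebra.ι F (0 : Fin 2) * FreeAlgebra.ι F (1 : Fin 2))
      (FreeAlgebra.ι F (1 : Fin 2) * FreeAlgebra.ι F (0 : Fin 2) + algebraMap F _ θ)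

/-- The Weyl algebra `W(θ)` with generators `A, B` and relation `AB - BA = θ`. -/
abbrev Weyl (F : Type*) [Field F] (θ : F) := RingQuot (WeylRel F θ)

/-- The standard generators `A, B` of the Weyl algebra. -/
def Weylgen (F : Type*) [Field F] (θ : F) (i : Fin 2) : Weyl F θ :=
  RingQuot.mkAlgHom F (WeylRel F θ) (FreeAlgebra.ι F i)

/-- If `xy - yx = θ`, then `x, y` satisfy the down-up relations with parameters
`ξ + 1, -ξ, (ξ - 1)θ`. -/
theorem downUp_of_mul_eq_mul_add {F T : Type*} [Field F] [Ring T] [Algebra F T] (θ ξ : F)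
    {x y : T} (h : x * y = y * x + algebraMap F T θ) :
    y * x ^ 2 = (ξ + 1) • (x * y * x) + (-ξ) • (x ^ 2 * y) + ((ξ - 1) * θ) • x ∧
    y ^ 2 * x = (ξ + 1) • (y * x * y) + (-ξ) • (x * y ^ 2) + ((ξ - 1) * θ) • y := by
  rw [Algebra.algebraMap_eq_smul_one] at h
  have hxyx : x * y * x = y * x ^ 2 + θ • x := by
    rw [h, add_mul, smul_mul_assoc, one_mul, mul_assoc, ← sq]
  have hxxy : x ^ 2 * y = y * x ^ 2 + (2 * θ) • x := by
    rw [sq, mul_assoc, h, mul_add, mul_smul_comm, mul_one, ← mul_assoc, hxyx, sq]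
    module
  have hyxy : y * x * y = y ^ 2 * x + θ • y := by
    rw [mul_assoc, h, mul_add, mul_smul_comm, mul_one, ← mul_assoc, ← sq]
  have hxyy : x * y ^ 2 = y ^ 2 * x + (2 * θ) • y := by
    rw [sq, ← mul_assoc, h, add_mul, smul_mul_assoc, one_mul, hyxy, sq]
    module
  rw [hxyx, hxxy, hyxy, hxyy]
  constructor <;> module

/-- If `AB - BA = θ`, then `A`, `B` and `-A - B` satisfy the `Z3`-symmetric down-up relations
with parameters `ξ + 1, -ξ, (ξ - 1)θ`. -/
theorem satisfiesDU_of_mul_eq_mul_add {F T : Type*} [Field F] [Ring T] [Algebra F T] (θ ξ : F)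
    {A B : T} (hAB : A * B = B * A + algebraMap F T θ) :
    SatisfiesDU (ξ + 1) (-ξ) ((ξ - 1) * θ) A B (-A - B) := by
  have hBC : B * (-A - B) = (-A - B) * B + algebraMap F T θ := by
    rw [mul_sub, sub_mul, mul_neg, neg_mul, hAB]
    abel
  have hCA : (-A - B) * A = A * (-A - B) + algebraMap F T θ := by
    rw [mul_sub, sub_mul, mul_neg, neg_mul, hAB]
    abel
  obtain ⟨h1, h2⟩ := downUp_of_mul_eq_mul_add θ ξ hAB
  obtain ⟨h3, h4⟩ := downUp_of_mul_eq_mul_add θ ξ hBC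
  obtain ⟨h5, h6⟩ := downUp_of_mul_eq_mul_add θ ξ hCA
  exact ⟨h1, h2, h3, h4, h5, h6⟩

/-- The defining relation of the Weyl algebra, for its standard generators. -/
theorem weylgen_zero_mul_one (F : Type*) [Field F] (θ : F) :
    Weylgen F θ 0 * Weylgen F θ 1 =
      Weylgen F θ 1 * Weylgen F θ 0 + algebraMap F (Weyl F θ) θ := by
  simpa [Weylgen] using RingQuot.mkAlgHom_rel F (WeylRel.r (F := F) (θ := θ))

/-- Elements satisfying the `Z3`-symmetric down-up relations are the images of the standard
generators under an algebra homomorphism. -/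
theorem SatisfiesDU.exists_algHom {F T : Type*} [Field F] [Ring T] [Algebra F T] {α β γ : F}
    {A B C : T} (h : SatisfiesDU α β γ A B C) :
    ∃ f : DU F α β γ →ₐ[F] T,
      f (DUgen F α β γ 0) = A ∧ f (DUgen F α β γ 1) = B ∧ f (DUgen F α β γ 2) = C := by
  obtain ⟨h1, h2, h3, h4, h5, h6⟩ := h
  refine ⟨RingQuot.liftAlgHom F ⟨FreeAlgebra.lift F ![A, B, C], ?_⟩, ?_, ?_, ?_⟩
  · intro x y hxy
    cases hxy <;>
      simp only [map_add, map_mul, map_pow, map_smul, FreeAlgebra.lift_ι_apply,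
        Matrix.cons_val] <;>
      assumption
  all_goals simp [DUgen]

/-- an algebra homomorphism `𝔸(ξ+1, -ξ, (ξ-1)θ) → W(θ)` sending `A ↦ A`,
`B ↦ B`, `C ↦ -A - B`; in particular `A, B, C := -A-B` in `W(θ)` satisfy the
Z3-symmetric down-up relations with parameters `ξ+1, -ξ, (ξ-1)θ`. -/
theorem stmt4 (F : Type*) [Field F] [IsAlgClosed F] [CharZero F] (θ ξ : F) :
    (∃ f : DU F (ξ + 1) (-ξ) ((ξ - 1) * θ) →ₐ[F] Weyl F θ,
      f (DUgen F (ξ + 1) (-ξ) ((ξ - 1) * θ) 0) = Weylgen F θ 0 ∧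
      f (DUgen F (ξ + 1) (-ξ) ((ξ - 1) * θ) 1) = Weylgen F θ 1 ∧
      f (DUgen F (ξ + 1) (-ξ) ((ξ - 1) * θ) 2) = -Weylgen F θ 0 - Weylgen F θ 1) ∧
    SatisfiesDU (ξ + 1) (-ξ) ((ξ - 1) * θ)
      (Weylgen F θ 0) (Weylgen F θ 1) (-Weylgen F θ 0 - Weylgen F θ 1) := by
  have h := satisfiesDU_of_mul_eq_mul_add θ ξ (weylgen_zero_mul_one F θ)
  exact ⟨h.exists_algHom, h⟩
end
end

section
/- For theta in F, the vector space W(theta) (the Z3-symmetric Weyl algebra with parameter theta) has a basis consisting of the monomials A^i B^j C^k for i, j, k natural numbers. -/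
noncomputable section

/-- The defining relations `AB - BA = θ`, `BC - CB = θ`, `CA - AC = θ` of the
Z3-symmetric Weyl algebra, with `A = 0`, `B = 1`, `C = 2`. -/
inductive W3Rel (F : Type*) [Field F] (θ : F) :
    FreeAlgebra F (Fin 3) → FreeAlgebra F (Fin 3) → Prop
  | r1 : W3Rel F θ (XX F 0 * XX F 1) (XX F 1 * XX F 0 + algebraMap F _ θ)
  | r2 : W3Rel F θ (XX F 1 * XX F 2) (XX F 2 * XX F 1 + algebraMap F _ θ)
  | r3 : W3Rel F θ (XX F 2 * XX F 0) (XX F 0 * XX F 2 + algebraMap F _ θ)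

/-- The Z3-symmetric Weyl algebra `𝕎(θ)`. -/
abbrev W3 (F : Type*) [Field F] (θ : F) := RingQuot (W3Rel F θ)

/-- The standard generators `A, B, C` of the Z3-symmetric Weyl algebra. -/
def W3gen (F : Type*) [Field F] (θ : F) (i : Fin 3) : W3 F θ :=
  RingQuot.mkAlgHom F (W3Rel F θ) (XX F i)

namespace W3

open MvPolynomial

variable {F : Type*} [Field F]

section Relations

variable (θ : F)

theorem gen_zero_mul_gen_one : W3gen F θ 0 * W3gen F θ 1 =
    W3gen F θ 1 * W3gen F θ 0 + algebraMap F _ θ := by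
  simpa [W3gen] using RingQuot.mkAlgHom_rel F (W3Rel.r1 (F := F) (θ := θ))

theorem gen_one_mul_gen_two : W3gen F θ 1 * W3gen F θ 2 =
    W3gen F θ 2 * W3gen F θ 1 + algebraMap F _ θ := by
  simpa [W3gen] using RingQuot.mkAlgHom_rel F (W3Rel.r2 (F := F) (θ := θ))

theorem gen_two_mul_gen_zero : W3gen F θ 2 * W3gen F θ 0 =
    W3gen F θ 0 * W3gen F θ 2 + algebraMap F _ θ := by
  simpa [W3gen] using RingQuot.mkAlgHom_rel F (W3Rel.r3 (F := F) (θ := θ))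

end Relations

/-- If `b` and `a` commute up to a scalar `t`, then `b` acts on powers of `a` by a derivation. -/
theorem mul_pow_of_mul_eq_add_algebraMap {R : Type*} [Ring R] [Algebra F R] {a b : R} {t : F}
    (h : b * a = a * b + algebraMap F R t) (n : ℕ) :
    b * a ^ n = a ^ n * b + (n * t) • a ^ (n - 1) := by
  induction n with
  | zero => simp
  | succ n ih =>
    have key : (n * t) • (a ^ (n - 1) * a) = (n * t) • a ^ n := by
      cases n with
      | zero => simp
      | succ m => simp [pow_succ]
    rw [pow_succ, ← mul_assoc, ih, add_mul, mul_assoc, h, smul_mul_assoc, key, mul_add,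
      ← Algebra.commutes, ← Algebra.smul_def, Nat.add_sub_cancel, Nat.cast_succ, add_mul,
      one_mul, add_smul]
    simp only [mul_assoc]
    abel

/-- The ordered monomial `A ^ i * B ^ j * C ^ k`. -/
def orderedMonomial (θ : F) (p : ℕ × ℕ × ℕ) : W3 F θ :=
  W3gen F θ 0 ^ p.1 * W3gen F θ 1 ^ p.2.1 * W3gen F θ 2 ^ p.2.2

theorem gen_zero_mul_orderedMonomial (θ : F) (i j k : ℕ) :
    W3gen F θ 0 * orderedMonomial θ (i, j, k) = orderedMonomial θ (i + 1, j, k) := by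
  simp only [orderedMonomial, pow_succ', mul_assoc]

theorem gen_one_mul_orderedMonomial (θ : F) (i j k : ℕ) :
    W3gen F θ 1 * orderedMonomial θ (i, j, k) =
      orderedMonomial θ (i, j + 1, k) + (i * -θ) • orderedMonomial θ (i - 1, j, k) := by
  have h : W3gen F θ 1 * W3gen F θ 0 = W3gen F θ 0 * W3gen F θ 1 + algebraMap F _ (-θ) := by
    rw [gen_zero_mul_gen_one, map_neg, add_neg_cancel_right]
  simp only [orderedMonomial]
  rw [← mul_assoc, ← mul_assoc, mul_pow_of_mul_eq_add_algebraMap h, pow_succ']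
  simp only [add_mul, smul_mul_assoc, mul_assoc]

theorem gen_two_mul_orderedMonomial (θ : F) (i j k : ℕ) :
    W3gen F θ 2 * orderedMonomial θ (i, j, k) =
      orderedMonomial θ (i, j, k + 1) + (j * -θ) • orderedMonomial θ (i, j - 1, k) +
        (i * θ) • orderedMonomial θ (i - 1, j, k) := by
  have h : W3gen F θ 2 * W3gen F θ 1 = W3gen F θ 1 * W3gen F θ 2 + algebraMap F _ (-θ) := by
    rw [gen_one_mul_gen_two, map_neg, add_neg_cancel_right]
  simp only [orderedMonomial]
  rw [← mul_assoc, ← mul_assoc, mul_pow_of_mul_eq_add_algebraMap (gen_two_mul_gen_zero θ),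
    add_mul, mul_assoc (W3gen F θ 0 ^ i), mul_pow_of_mul_eq_add_algebraMap h, pow_succ']
  simp only [add_mul, mul_add, smul_mul_assoc, mul_smul_comm, mul_assoc]

theorem gen_mul_orderedMonomial_mem_span (θ : F) (m : Fin 3) (p : ℕ × ℕ × ℕ) :
    W3gen F θ m * orderedMonomial θ p ∈ Submodule.span F (Set.range (orderedMonomial θ)) := by
  have hmem (q : ℕ × ℕ × ℕ) :
      orderedMonomial θ q ∈ Submodule.span F (Set.range (orderedMonomial θ)) :=
    Submodule.subset_span ⟨q, rfl⟩
  obtain ⟨i, j, k⟩ := p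
  fin_cases m
  · exact gen_zero_mul_orderedMonomial θ i j k ▸ hmem _
  · exact gen_one_mul_orderedMonomial θ i j k ▸
      add_mem (hmem _) (Submodule.smul_mem _ _ (hmem _))
  · exact gen_two_mul_orderedMonomial θ i j k ▸
      add_mem (add_mem (hmem _) (Submodule.smul_mem _ _ (hmem _)))
        (Submodule.smul_mem _ _ (hmem _))

theorem mkAlgHom_mul_mem_span (θ : F) (x : FreeAlgebra F (Fin 3)) :
    ∀ w ∈ Submodule.span F (Set.range (orderedMonomial θ)),
      RingQuot.mkAlgHom F (W3Rel F θ) x * w ∈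
        Submodule.span F (Set.range (orderedMonomial θ)) := by
  induction x using FreeAlgebra.induction with
  | grade0 r =>
    intro w hw
    rw [AlgHom.commutes, ← Algebra.smul_def]
    exact Submodule.smul_mem _ _ hw
  | grade1 m =>
    intro w hw
    induction hw using Submodule.span_induction with
    | mem w hw =>
      obtain ⟨p, rfl⟩ := hw
      exact gen_mul_orderedMonomial_mem_span θ m p
    | zero => simp
    | add v w _ _ hv hw => rw [mul_add]; exact add_mem hv hw
    | smul r w _ hw => rw [mul_smul_comm]; exact Submodule.smul_mem _ _ hw
  | mul x y hx hy =>
    intro w hw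
    rw [map_mul, mul_assoc]
    exact hx _ (hy _ hw)
  | add x y hx hy =>
    intro w hw
    rw [map_add, add_mul]
    exact add_mem (hx _ hw) (hy _ hw)

theorem span_orderedMonomial (θ : F) :
    Submodule.span F (Set.range (orderedMonomial θ)) = ⊤ := by
  refine eq_top_iff.2 fun w _ => ?_
  obtain ⟨x, rfl⟩ := RingQuot.mkAlgHom_surjective F (W3Rel F θ) w
  rw [← mul_one (RingQuot.mkAlgHom F (W3Rel F θ) x)]
  exact mkAlgHom_mul_mem_span θ x 1 (Submodule.subset_span ⟨(0, 0, 0), by simp [orderedMonomial]⟩)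

theorem pderiv_pderiv_comm {R σ : Type*} [CommSemiring R] (i j : σ) (f : MvPolynomial σ R) :
    pderiv i (pderiv j f) = pderiv j (pderiv i f) := by
  classical
  induction f using MvPolynomial.induction_on with
  | C r => simp
  | add f g hf hg => simp [hf, hg]
  | mul_X f k hf =>
    simp only [pderiv_mul, map_add, hf, pderiv_X, Pi.single_apply]
    split_ifs <;> simp [add_comm, add_left_comm]

/-- The operators `x`, `y - θ ∂/∂x`, `z + θ ∂/∂x - θ ∂/∂y` on `F[x, y, z]`. -/
def polyOp (θ : F) : Fin 3 → Module.End F (MvPolynomial (Fin 3) F) :=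
  ![LinearMap.mulLeft F (X 0),
    LinearMap.mulLeft F (X 1) - θ • (pderiv 0).toLinearMap,
    LinearMap.mulLeft F (X 2) + θ • (pderiv 0).toLinearMap - θ • (pderiv 1).toLinearMap]

theorem polyOp_zero_apply (θ : F) (f : MvPolynomial (Fin 3) F) : polyOp θ 0 f = X 0 * f := rfl

theorem polyOp_one_apply (θ : F) (f : MvPolynomial (Fin 3) F) :
    polyOp θ 1 f = X 1 * f - C θ * pderiv 0 f := by
  simp [polyOp, smul_eq_C_mul]

theorem polyOp_two_apply (θ : F) (f : MvPolynomial (Fin 3) F) :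
    polyOp θ 2 f = X 2 * f + C θ * pderiv 0 f - C θ * pderiv 1 f := by
  simp [polyOp, smul_eq_C_mul]

/-- The representation of `𝕎(θ)` on `F[x, y, z]` by differential operators. -/
def polyRep (θ : F) : W3 F θ →ₐ[F] Module.End F (MvPolynomial (Fin 3) F) :=
  RingQuot.liftAlgHom F ⟨FreeAlgebra.lift F (polyOp θ), by
    intro x y h
    induction h <;> refine LinearMap.ext fun f => ?_ <;>
    simp [polyOp_zero_apply, polyOp_one_apply, polyOp_two_apply, pderiv_X, smul_eq_C_mul,
      pderiv_pderiv_comm (R := F) (1 : Fin 3) 0] <;> ring⟩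

theorem polyRep_gen (θ : F) (m : Fin 3) : polyRep θ (W3gen F θ m) = polyOp θ m := by
  simp [polyRep, W3gen]

theorem polyOp_zero_pow_apply (θ : F) (i : ℕ) (f : MvPolynomial (Fin 3) F) :
    (polyOp θ 0 ^ i) f = X 0 ^ i * f := by
  induction i with
  | zero => simp
  | succ i ih => rw [pow_succ', Module.End.mul_apply, ih, polyOp_zero_apply, pow_succ', mul_assoc]

theorem polyOp_one_pow_apply (θ : F) (j k : ℕ) :
    (polyOp θ 1 ^ j) (X 2 ^ k) = X 1 ^ j * X 2 ^ k := by
  induction j with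
  | zero => simp
  | succ j ih =>
    rw [pow_succ', Module.End.mul_apply, ih, polyOp_one_apply]
    simp [pderiv_X, Derivation.leibniz_pow, pow_succ', mul_assoc]

theorem polyOp_two_pow_apply (θ : F) (k : ℕ) : (polyOp θ 2 ^ k) 1 = X 2 ^ k := by
  induction k with
  | zero => simp
  | succ k ih =>
    rw [pow_succ', Module.End.mul_apply, ih, polyOp_two_apply]
    simp [pderiv_X, Derivation.leibniz_pow, pow_succ']

theorem polyRep_orderedMonomial_one (θ : F) (p : ℕ × ℕ × ℕ) :
    polyRep θ (orderedMonomial θ p) 1 = X 0 ^ p.1 * (X 1 ^ p.2.1 * X 2 ^ p.2.2) := by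
  simp only [orderedMonomial, map_mul, map_pow, polyRep_gen, Module.End.mul_apply,
    polyOp_two_pow_apply, polyOp_one_pow_apply, polyOp_zero_pow_apply]

theorem linearIndependent_X_pow_mul : LinearIndependent F fun p : ℕ × ℕ × ℕ =>
    (X 0 ^ p.1 * (X 1 ^ p.2.1 * X 2 ^ p.2.2) : MvPolynomial (Fin 3) F) := by
  let e : ℕ × ℕ × ℕ → Fin 3 →₀ ℕ := fun p =>
    Finsupp.single 0 p.1 + (Finsupp.single 1 p.2.1 + Finsupp.single 2 p.2.2)
  have he : Function.Injective e := fun p q h => by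
    have h0 := DFunLike.congr_fun h 0
    have h1 := DFunLike.congr_fun h 1
    have h2 := DFunLike.congr_fun h 2
    simp [e] at h0 h1 h2
    exact Prod.ext h0 (Prod.ext h1 h2)
  have hfun : (fun p : ℕ × ℕ × ℕ =>
      (X 0 ^ p.1 * (X 1 ^ p.2.1 * X 2 ^ p.2.2) : MvPolynomial (Fin 3) F)) =
        basisMonomials (Fin 3) F ∘ e := by
    funext p
    simp [e, X_pow_eq_monomial, monomial_mul]
  rw [hfun]
  exact (basisMonomials (Fin 3) F).linearIndependent.comp e he

theorem linearIndependent_orderedMonomial (θ : F) :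
    LinearIndependent F (orderedMonomial θ) := by
  refine LinearIndependent.of_comp
    ((LinearMap.applyₗ (1 : MvPolynomial (Fin 3) F)).comp (polyRep θ).toLinearMap) ?_
  convert linearIndependent_X_pow_mul (F := F) using 2 with p
  exact polyRep_orderedMonomial_one θ p

end W3

/-- the monomials `A^i B^j C^k` (`i,j,k ∈ ℕ`) form a basis of the Z3-symmetric
Weyl algebra `𝕎(θ)`. -/
theorem stmt5 (F : Type*) [Field F] [IsAlgClosed F] [CharZero F] (θ : F) :
    LinearIndependent F
        (fun p : ℕ × ℕ × ℕ => W3gen F θ 0 ^ p.1 * W3gen F θ 1 ^ p.2.1 * W3gen F θ 2 ^ p.2.2) ∧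
      Submodule.span F
        (Set.range fun p : ℕ × ℕ × ℕ =>
          W3gen F θ 0 ^ p.1 * W3gen F θ 1 ^ p.2.1 * W3gen F θ 2 ^ p.2.2) = ⊤ :=
  ⟨W3.linearIndependent_orderedMonomial θ, W3.span_orderedMonomial θ⟩
end
end

section
/- Pick theta, xi in F and consider the Z3-symmetric down-up algebra A(xi+1, -xi, (xi-1)*theta). There exists an algebra homomorphism from A(xi+1, -xi, (xi-1)*theta) to the Z3-symmetric Weyl algebra W(theta) that sends A to A, B to B, and C to C. -/
noncomputable section

section WeylPair

variable {F R : Type*} [Field F] [Ring R] [Algebra F R] {θ : F} {x y : R}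

lemma weyl_mul_sq (h : x * y = y * x + algebraMap F R θ) (ξ : F) :
    y * x ^ 2 = (ξ + 1) • (x * y * x) + (-ξ) • (x ^ 2 * y) + ((ξ - 1) * θ) • x := by
  have left : y * x ^ 2 = x * y * x - θ • x := by
    rw [h, add_mul, ← Algebra.smul_def, add_sub_cancel_right, pow_two, mul_assoc]
  have right : x ^ 2 * y = x * y * x + θ • x := by
    rw [pow_two, mul_assoc, h, mul_add, ← Algebra.commutes, ← Algebra.smul_def, ← mul_assoc, h]
  rw [left, right]
  module

lemma weyl_sq_mul (h : x * y = y * x + algebraMap F R θ) (ξ : F) :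
    y ^ 2 * x = (ξ + 1) • (y * x * y) + (-ξ) • (x * y ^ 2) + ((ξ - 1) * θ) • y := by
  have left : y ^ 2 * x = y * x * y - θ • y := by
    rw [mul_assoc y x y, h, mul_add, ← Algebra.commutes, ← Algebra.smul_def,
      add_sub_cancel_right, pow_two, mul_assoc]
  have right : x * y ^ 2 = y * x * y + θ • y := by
    rw [pow_two, ← mul_assoc, h, add_mul, ← Algebra.smul_def]
  rw [left, right]
  module

end WeylPair

lemma W3gen_mul_zero_one (F : Type*) [Field F] (θ : F) :
    W3gen F θ 0 * W3gen F θ 1 = W3gen F θ 1 * W3gen F θ 0 + algebraMap F _ θ := by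
  simpa only [W3gen, map_mul, map_add, AlgHom.commutes] using
    RingQuot.mkAlgHom_rel F (W3Rel.r1 (F := F) (θ := θ))

lemma W3gen_mul_one_two (F : Type*) [Field F] (θ : F) :
    W3gen F θ 1 * W3gen F θ 2 = W3gen F θ 2 * W3gen F θ 1 + algebraMap F _ θ := by
  simpa only [W3gen, map_mul, map_add, AlgHom.commutes] using
    RingQuot.mkAlgHom_rel F (W3Rel.r2 (F := F) (θ := θ))

lemma W3gen_mul_two_zero (F : Type*) [Field F] (θ : F) :
    W3gen F θ 2 * W3gen F θ 0 = W3gen F θ 0 * W3gen F θ 2 + algebraMap F _ θ := by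
  simpa only [W3gen, map_mul, map_add, AlgHom.commutes] using
    RingQuot.mkAlgHom_rel F (W3Rel.r3 (F := F) (θ := θ))

/-- an algebra homomorphism `𝔸(ξ+1, -ξ, (ξ-1)θ) → 𝕎(θ)` sending
`A ↦ A`, `B ↦ B`, `C ↦ C`. -/
theorem stmt6 (F : Type*) [Field F] [IsAlgClosed F] [CharZero F] (θ ξ : F) :
    ∃ f : DU F (ξ + 1) (-ξ) ((ξ - 1) * θ) →ₐ[F] W3 F θ,
      f (DUgen F (ξ + 1) (-ξ) ((ξ - 1) * θ) 0) = W3gen F θ 0 ∧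
      f (DUgen F (ξ + 1) (-ξ) ((ξ - 1) * θ) 1) = W3gen F θ 1 ∧
      f (DUgen F (ξ + 1) (-ξ) ((ξ - 1) * θ) 2) = W3gen F θ 2 := by
  refine ⟨RingQuot.liftAlgHom F ⟨FreeAlgebra.lift F (W3gen F θ), fun a b hab => ?_⟩, ?_, ?_, ?_⟩
  · cases hab <;>
      simp only [map_mul, map_add, map_pow, map_smul, FreeAlgebra.lift_ι_apply]
    · exact weyl_mul_sq (W3gen_mul_zero_one F θ) ξ
    · exact weyl_sq_mul (W3gen_mul_zero_one F θ) ξ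
    · exact weyl_mul_sq (W3gen_mul_one_two F θ) ξ
    · exact weyl_sq_mul (W3gen_mul_one_two F θ) ξ
    · exact weyl_mul_sq (W3gen_mul_two_zero F θ) ξ
    · exact weyl_sq_mul (W3gen_mul_two_zero F θ) ξ
  all_goals
    rw [DUgen, RingQuot.liftAlgHom_mkAlgHom_apply, FreeAlgebra.lift_ι_apply]
end
end

section
/- Let alpha, beta, gamma in F with alpha nonzero. Then there exists an algebra homomorphism from the Z3-symmetric down-up algebra A(alpha,beta,gamma) to the reduced Z3-symmetric down-up algebra R(-gamma/alpha) that sends A to A, B to B, and C to C. -/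
noncomputable section

/-- The defining relations of the reduced Z3-symmetric down-up algebra `ℝ𝕕(θ)`,
with `A = 0`, `B = 1`, `C = 2`. -/
inductive RedRel (F : Type*) [Field F] (θ : F) :
    FreeAlgebra F (Fin 3) → FreeAlgebra F (Fin 3) → Prop
  | a2 : RedRel F θ (XX F 0 ^ 2) 0
  | b2 : RedRel F θ (XX F 1 ^ 2) 0
  | c2 : RedRel F θ (XX F 2 ^ 2) 0
  | aba : RedRel F θ (XX F 0 * XX F 1 * XX F 0) (θ • XX F 0)
  | bcb : RedRel F θ (XX F 1 * XX F 2 * XX F 1) (θ • XX F 1)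
  | cac : RedRel F θ (XX F 2 * XX F 0 * XX F 2) (θ • XX F 2)
  | bab : RedRel F θ (XX F 1 * XX F 0 * XX F 1) (θ • XX F 1)
  | cbc : RedRel F θ (XX F 2 * XX F 1 * XX F 2) (θ • XX F 2)
  | aca : RedRel F θ (XX F 0 * XX F 2 * XX F 0) (θ • XX F 0)

/-- The reduced Z3-symmetric down-up algebra `R(θ)`. -/
abbrev Red (F : Type*) [Field F] (θ : F) := RingQuot (RedRel F θ)

/-- The standard generators `A, B, C` of `R(θ)`. -/
def Redgen (F : Type*) [Field F] (θ : F) (i : Fin 3) : Red F θ :=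
  RingQuot.mkAlgHom F (RedRel F θ) (XX F i)

/-- A relation of the reduced algebra holds between the images of its two sides. -/
theorem mkAlgHom_redRel {F : Type*} [Field F] {θ : F} {x y : FreeAlgebra F (Fin 3)}
    (h : RedRel F θ x y) :
    RingQuot.mkAlgHom F (RedRel F θ) x = RingQuot.mkAlgHom F (RedRel F θ) y :=
  RingQuot.mkAlgHom_rel F h

/-- The quotient map onto `R(-γ/α)` respects the relations of the down-up algebra. -/
theorem mkAlgHom_redRel_of_duRel {F : Type*} [Field F] {α β γ : F} (hα : α ≠ 0)
    {x y : FreeAlgebra F (Fin 3)} (h : DURel F α β γ x y) :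
    RingQuot.mkAlgHom F (RedRel F (-(γ / α))) x =
      RingQuot.mkAlgHom F (RedRel F (-(γ / α))) y := by
  have hθ : α * -(γ / α) = -γ := by field_simp
  have ha := mkAlgHom_redRel (RedRel.a2 (F := F) (θ := -(γ / α)))
  have hb := mkAlgHom_redRel (RedRel.b2 (F := F) (θ := -(γ / α)))
  have hc := mkAlgHom_redRel (RedRel.c2 (F := F) (θ := -(γ / α)))
  have key (u v w z : FreeAlgebra F (Fin 3)) (hw : RedRel F (-(γ / α)) w (-(γ / α) • u))
      (hv : RingQuot.mkAlgHom F (RedRel F (-(γ / α))) v = 0)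
      (hz : RingQuot.mkAlgHom F (RedRel F (-(γ / α))) z = 0) :
      RingQuot.mkAlgHom F (RedRel F (-(γ / α))) v =
        RingQuot.mkAlgHom F (RedRel F (-(γ / α))) (α • w + β • z + γ • u) := by
    rw [map_add, map_add, map_smul, map_smul, map_smul, mkAlgHom_redRel hw, map_smul, hv, hz,
      smul_zero, add_zero, smul_smul, hθ, neg_smul, neg_add_cancel]
  cases h with
  | r1 => refine key _ _ _ _ .aba ?_ ?_ <;> simp only [map_mul, ha, map_zero, mul_zero, zero_mul]
  | r2 => refine key _ _ _ _ .bab ?_ ?_ <;> simp only [map_mul, hb, map_zero, mul_zero, zero_mul]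
  | r3 => refine key _ _ _ _ .bcb ?_ ?_ <;> simp only [map_mul, hb, map_zero, mul_zero, zero_mul]
  | r4 => refine key _ _ _ _ .cbc ?_ ?_ <;> simp only [map_mul, hc, map_zero, mul_zero, zero_mul]
  | r5 => refine key _ _ _ _ .cac ?_ ?_ <;> simp only [map_mul, hc, map_zero, mul_zero, zero_mul]
  | r6 => refine key _ _ _ _ .aca ?_ ?_ <;> simp only [map_mul, ha, map_zero, mul_zero, zero_mul]

/-- for `α ≠ 0` there is an algebra homomorphism
`𝔸(α,β,γ) → R(-γ/α)` sending `A ↦ A`, `B ↦ B`, `C ↦ C`. -/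
theorem stmt8 (F : Type*) [Field F] [IsAlgClosed F] [CharZero F] (α β γ : F) (hα : α ≠ 0) :
    ∃ f : DU F α β γ →ₐ[F] Red F (-(γ / α)),
      f (DUgen F α β γ 0) = Redgen F (-(γ / α)) 0 ∧
      f (DUgen F α β γ 1) = Redgen F (-(γ / α)) 1 ∧
      f (DUgen F α β γ 2) = Redgen F (-(γ / α)) 2 := by
  exact ⟨RingQuot.liftAlgHom F ⟨RingQuot.mkAlgHom F (RedRel F (-(γ / α))),
      fun _ _ h => mkAlgHom_redRel_of_duRel hα h⟩,
    RingQuot.liftAlgHom_mkAlgHom_apply F _ _ _, RingQuot.liftAlgHom_mkAlgHom_apply F _ _ _,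
    RingQuot.liftAlgHom_mkAlgHom_apply F _ _ _⟩
end
end

section
/- For theta in F, the reduced Z3-symmetric down-up algebra R(theta) has a basis consisting of the products of standard generators X_1 X_2 ... X_n (with n a natural number, each X_i one of A, B, C, and the empty product equal to 1) such that X_{i-1} is not equal to X_i for 2 <= i <= n, and X_{i-1} is not equal to X_{i+1} for 2 <= i <= n-1. -/
noncomputable section

/-- The product of standard generators of `R(θ)` indexed by a word (empty product is `1`). -/
def RedWordProd (F : Type*) [Field F] (θ : F) (w : List (Fin 3)) : Red F θ :=
  (w.map (Redgen F θ)).prod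

/-- A word is reduced when no two consecutive letters are equal and no two letters at
distance two are equal, i.e., no infix of the form `[x,x]` or `[x,y,x]`. -/
def RedAdmissible (w : List (Fin 3)) : Prop :=
  (∀ x : Fin 3, ¬ [x, x] <:+: w) ∧ (∀ x y : Fin 3, ¬ [x, y, x] <:+: w)

theorem redAdmissible_nil : RedAdmissible [] := by
  constructor <;> intros <;> simp

theorem redAdmissible_cons (x : Fin 3) (w : List (Fin 3)) :
    RedAdmissible (x :: w) ↔ RedAdmissible w ∧ w[0]? ≠ some x ∧ w[1]? ≠ some x := by
  unfold RedAdmissible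
  rcases w with _ | ⟨a, _ | ⟨b, w⟩⟩
  · simp [List.infix_cons_iff]
  · simp [List.infix_cons_iff]
    grind
  · simp only [List.infix_cons_iff (l₂ := a :: b :: w), List.cons_prefix_cons]
    simp
    grind

theorem Redgen_mul_self (F : Type*) [Field F] (θ : F) (x : Fin 3) :
    Redgen F θ x * Redgen F θ x = 0 := by
  unfold Redgen
  rw [← map_mul, ← pow_two, ← map_zero (RingQuot.mkAlgHom F (RedRel F θ))]
  fin_cases x <;> apply RingQuot.mkAlgHom_rel <;> constructor

theorem Redgen_mul_mul (F : Type*) [Field F] (θ : F) {x y : Fin 3} (h : x ≠ y) :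
    Redgen F θ x * (Redgen F θ y * Redgen F θ x) = θ • Redgen F θ x := by
  unfold Redgen
  rw [← mul_assoc, ← map_mul, ← map_mul, ← map_smul]
  fin_cases x <;> fin_cases y <;> first | exact absurd rfl h | skip
  all_goals apply RingQuot.mkAlgHom_rel; constructor

theorem RedWordProd_cons (F : Type*) [Field F] (θ : F) (x : Fin 3) (w : List (Fin 3)) :
    RedWordProd F θ (x :: w) = Redgen F θ x * RedWordProd F θ w := by
  simp [RedWordProd]

open Classical in
/-- Left multiplication by a generator on a word, rewritten in terms of reduced words
(and set to zero on words that are not reduced). -/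
def redWordAct (F : Type*) [Field F] (θ : F) (x : Fin 3) (w : List (Fin 3)) :
    List (Fin 3) →₀ F :=
  if ¬ RedAdmissible w then 0
  else if w[0]? = some x then 0
  else if w[1]? = some x then θ • Finsupp.single w.tail 1
  else Finsupp.single (x :: w) 1

/-- The linear operator by which a generator acts on the space spanned by words. -/
def redAct (F : Type*) [Field F] (θ : F) (x : Fin 3) :
    Module.End F (List (Fin 3) →₀ F) :=
  Finsupp.linearCombination F (redWordAct F θ x)

theorem redAct_single (F : Type*) [Field F] (θ : F) (x : Fin 3) (w : List (Fin 3)) :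
    redAct F θ x (Finsupp.single w 1) = redWordAct F θ x w := by
  simp [redAct]

theorem redWordAct_of_admissible (F : Type*) [Field F] (θ : F) {x : Fin 3} {w : List (Fin 3)}
    (h : RedAdmissible (x :: w)) : redWordAct F θ x w = Finsupp.single (x :: w) 1 := by
  have := (redAdmissible_cons x w).1 h
  simp [redWordAct, this]

theorem redWordAct_of_not_admissible (F : Type*) [Field F] (θ : F) (x : Fin 3)
    {w : List (Fin 3)} (h : ¬ RedAdmissible w) : redWordAct F θ x w = 0 := by
  simp [redWordAct, h]

theorem redWordAct_cons_self (F : Type*) [Field F] (θ : F) (x : Fin 3) (w : List (Fin 3)) :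
    redWordAct F θ x (x :: w) = 0 := by
  simp [redWordAct]

theorem redWordAct_cons_cons (F : Type*) [Field F] (θ : F) {x y : Fin 3} {w : List (Fin 3)}
    (h : RedAdmissible (y :: x :: w)) :
    redWordAct F θ x (y :: x :: w) = θ • Finsupp.single (x :: w) 1 := by
  have h' := (redAdmissible_cons y (x :: w)).1 h
  have hne : y ≠ x := fun e => h'.2.1 (by simp [e])
  simp [redWordAct, h, hne]

/-- Prepending a letter to a reduced word gives a cancellation `x x`, a contraction `x y x`,
or a reduced word. -/
theorem RedAdmissible.cons_cases {w : List (Fin 3)} (h : RedAdmissible w) (x : Fin 3) :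
    (∃ u, w = x :: u) ∨ (∃ y u, w = y :: x :: u) ∨ RedAdmissible (x :: w) := by
  rw [redAdmissible_cons]
  rcases w with _ | ⟨a, _ | ⟨b, w⟩⟩ <;> grind

theorem redAct_mul_self (F : Type*) [Field F] (θ : F) (x : Fin 3) :
    redAct F θ x * redAct F θ x = 0 := by
  refine Finsupp.lhom_ext' fun w => LinearMap.ext_ring ?_
  by_cases hw : RedAdmissible w
  · rcases hw.cons_cases x with ⟨u, rfl⟩ | ⟨y, u, rfl⟩ | h
    · simp [-Finsupp.smul_single, redAct_single, redWordAct_cons_self]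
    · simp [-Finsupp.smul_single, redAct_single, redWordAct_cons_cons F θ hw, redWordAct_cons_self]
    · simp [-Finsupp.smul_single, redAct_single, redWordAct_of_admissible F θ h, redWordAct_cons_self]
  · simp [-Finsupp.smul_single, redAct_single, redWordAct_of_not_admissible F θ x hw]

theorem redAct_mul_mul (F : Type*) [Field F] (θ : F) {x y : Fin 3} (hxy : x ≠ y) :
    redAct F θ x * redAct F θ y * redAct F θ x = θ • redAct F θ x := by
  refine Finsupp.lhom_ext' fun w => LinearMap.ext_ring ?_
  by_cases hw : RedAdmissible w
  · rcases hw.cons_cases x with ⟨u, rfl⟩ | ⟨z, u, rfl⟩ | h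
    · simp [-Finsupp.smul_single, redAct_single, redWordAct_cons_self]
    · have hu := ((redAdmissible_cons z _).1 hw).1
      rcases hu.cons_cases y with ⟨v, hv⟩ | ⟨t, v, hv⟩ | h
      · exact absurd (List.cons.inj hv).1 hxy
      · obtain ⟨rfl, rfl⟩ := List.cons.inj hv
        simp [-Finsupp.smul_single, redAct_single, redWordAct_cons_cons F θ hw, redWordAct_cons_cons F θ hu,
          redWordAct_of_admissible F θ hu]
      · simp [-Finsupp.smul_single, redAct_single, redWordAct_cons_cons F θ hw, redWordAct_of_admissible F θ h,
          redWordAct_cons_cons F θ h]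
    · rcases h.cons_cases y with ⟨v, hv⟩ | ⟨t, v, hv⟩ | h'
      · exact absurd (List.cons.inj hv).1 hxy
      · obtain ⟨rfl, rfl⟩ := List.cons.inj hv
        simp [-Finsupp.smul_single, redAct_single, redWordAct_of_admissible F θ h, redWordAct_cons_cons F θ h]
      · simp [-Finsupp.smul_single, redAct_single, redWordAct_of_admissible F θ h, redWordAct_of_admissible F θ h',
          redWordAct_cons_cons F θ h']
  · simp [-Finsupp.smul_single, redAct_single, redWordAct_of_not_admissible F θ x hw]

/-- The representation of `R(θ)` on the space spanned by words. -/
def redRep (F : Type*) [Field F] (θ : F) :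
    Red F θ →ₐ[F] Module.End F (List (Fin 3) →₀ F) :=
  RingQuot.liftAlgHom F ⟨FreeAlgebra.lift F (redAct F θ), by
    intro a b h
    cases h <;> simp only [XX, map_mul, map_smul, map_zero, FreeAlgebra.lift_ι_apply,
      pow_two, redAct_mul_self]
    all_goals exact redAct_mul_mul F θ (by decide)⟩

theorem redRep_gen (F : Type*) [Field F] (θ : F) (x : Fin 3) :
    redRep F θ (Redgen F θ x) = redAct F θ x := by
  simp [redRep, Redgen]

theorem redRep_wordProd (F : Type*) [Field F] (θ : F) {w : List (Fin 3)}
    (h : RedAdmissible w) :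
    redRep F θ (RedWordProd F θ w) (Finsupp.single [] 1) = Finsupp.single w 1 := by
  induction w with
  | nil => simp [RedWordProd]
  | cons x w ih =>
    rw [RedWordProd_cons, map_mul, Module.End.mul_apply,
      ih ((redAdmissible_cons x w).1 h).1, redRep_gen, redAct_single,
      redWordAct_of_admissible F θ h]

theorem linearIndependent_RedWordProd (F : Type*) [Field F] (θ : F) :
    LinearIndependent F
      (fun w : {w : List (Fin 3) // RedAdmissible w} => RedWordProd F θ w.1) := by
  let g : Red F θ →ₗ[F] (List (Fin 3) →₀ F) :=
    (LinearMap.applyₗ (Finsupp.single [] 1)).comp (redRep F θ).toLinearMap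
  refine LinearIndependent.of_comp g ?_
  have hg : g ∘ (fun w : {w : List (Fin 3) // RedAdmissible w} => RedWordProd F θ w.1) =
      (fun w : List (Fin 3) => Finsupp.single w (1 : F)) ∘ Subtype.val :=
    funext fun w => redRep_wordProd F θ w.2
  rw [hg]
  exact (Finsupp.linearIndependent_single_one F (List (Fin 3))).comp _ Subtype.val_injective

theorem Redgen_mul_mem_span (F : Type*) [Field F] (θ : F) (x : Fin 3) {s : Red F θ}
    (hs : s ∈ Submodule.span F
      (Set.range fun w : {w : List (Fin 3) // RedAdmissible w} => RedWordProd F θ w.1)) :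
    Redgen F θ x * s ∈ Submodule.span F
      (Set.range fun w : {w : List (Fin 3) // RedAdmissible w} => RedWordProd F θ w.1) := by
  induction hs using Submodule.span_induction with
  | mem s hs =>
    obtain ⟨⟨w, hw⟩, rfl⟩ := hs
    dsimp only
    rcases hw.cons_cases x with ⟨u, rfl⟩ | ⟨y, u, rfl⟩ | h
    · rw [RedWordProd_cons, ← mul_assoc, Redgen_mul_self, zero_mul]
      exact zero_mem _
    · have h' := (redAdmissible_cons y _).1 hw
      have hxy : x ≠ y := fun e => h'.2.1 (by simp [e])
      rw [RedWordProd_cons, RedWordProd_cons, ← mul_assoc (Redgen F θ y), ← mul_assoc,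
        Redgen_mul_mul F θ hxy, smul_mul_assoc, ← RedWordProd_cons]
      exact Submodule.smul_mem _ _ (Submodule.subset_span ⟨⟨_, h'.1⟩, rfl⟩)
    · rw [← RedWordProd_cons]
      exact Submodule.subset_span ⟨⟨_, h⟩, rfl⟩
  | zero => rw [mul_zero]; exact zero_mem _
  | add a b _ _ ha hb => rw [mul_add]; exact add_mem ha hb
  | smul c a _ ha => rw [mul_smul_comm]; exact Submodule.smul_mem _ _ ha

theorem span_RedWordProd (F : Type*) [Field F] (θ : F) :
    Submodule.span F
      (Set.range fun w : {w : List (Fin 3) // RedAdmissible w} => RedWordProd F θ w.1) = ⊤ := by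
  set S := Submodule.span F
    (Set.range fun w : {w : List (Fin 3) // RedAdmissible w} => RedWordProd F θ w.1) with hS
  have one_mem : (1 : Red F θ) ∈ S :=
    Submodule.subset_span ⟨⟨[], redAdmissible_nil⟩, by simp [RedWordProd]⟩
  have mul_mem (a : FreeAlgebra F (Fin 3)) :
      ∀ s ∈ S, RingQuot.mkAlgHom F (RedRel F θ) a * s ∈ S := by
    induction a using FreeAlgebra.induction with
    | grade0 r =>
      intro s hs
      rw [AlgHom.commutes, ← Algebra.smul_def]
      exact S.smul_mem _ hs
    | grade1 x => exact fun s hs => Redgen_mul_mem_span F θ x hs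
    | mul a b ha hb =>
      intro s hs
      rw [map_mul, mul_assoc]
      exact ha _ (hb _ hs)
    | add a b ha hb =>
      intro s hs
      rw [map_add, add_mul]
      exact add_mem (ha _ hs) (hb _ hs)
  refine eq_top_iff.2 fun r _ => ?_
  obtain ⟨a, rfl⟩ := RingQuot.mkAlgHom_surjective F (RedRel F θ) r
  simpa using mul_mem a 1 one_mem

/-- the products of standard generators along reduced words form a basis of the
reduced Z3-symmetric down-up algebra `R(θ)`. -/
theorem stmt9 (F : Type*) [Field F] [IsAlgClosed F] [CharZero F] (θ : F) :
    LinearIndependent F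
        (fun w : {w : List (Fin 3) // RedAdmissible w} => RedWordProd F θ w.1) ∧
      Submodule.span F
        (Set.range fun w : {w : List (Fin 3) // RedAdmissible w} => RedWordProd F θ w.1) = ⊤ :=
  ⟨linearIndependent_RedWordProd F θ, span_RedWordProd F θ⟩
end
end

section
/- Define the following elements of the Lie algebra sl_2 over F: A = [[1,-1],[1,-1]], B = [[0,0],[1,0]], C = [[0,-1],[0,0]]. Then A, B, C form a basis of sl_2, and [A,B] = C - A - B, [B,C] = A - B - C, [C,A] = B - C - A. -/
noncomputable section

open LieAlgebra.SpecialLinear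

/-- The element `A = [[1,-1],[1,-1]]` of `sl₂`. -/
def sl2A (F : Type*) [Field F] : sl (Fin 2) F :=
  ⟨!![1, -1; 1, -1], show Matrix.trace !![(1 : F), -1; 1, -1] = 0 by
    simp [Matrix.trace_fin_two]⟩

/-- The element `B = [[0,0],[1,0]]` of `sl₂`. -/
def sl2B (F : Type*) [Field F] : sl (Fin 2) F :=
  ⟨!![0, 0; 1, 0], show Matrix.trace !![(0 : F), 0; 1, 0] = 0 by
    simp [Matrix.trace_fin_two]⟩

/-- The element `C = [[0,-1],[0,0]]` of `sl₂`. -/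
def sl2C (F : Type*) [Field F] : sl (Fin 2) F :=
  ⟨!![0, -1; 0, 0], show Matrix.trace !![(0 : F), -1; 0, 0] = 0 by
    simp [Matrix.trace_fin_two]⟩

/-- `A, B, C` form a basis of `sl₂` and satisfy
`[A,B] = C - A - B`, `[B,C] = A - B - C`, `[C,A] = B - C - A`. -/
theorem stmt11 (F : Type*) [Field F] [IsAlgClosed F] [CharZero F] :
    (LinearIndependent F ![sl2A F, sl2B F, sl2C F] ∧
      Submodule.span F (Set.range ![sl2A F, sl2B F, sl2C F]) = ⊤) ∧
    ⁅sl2A F, sl2B F⁆ = sl2C F - sl2A F - sl2B F ∧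
    ⁅sl2B F, sl2C F⁆ = sl2A F - sl2B F - sl2C F ∧
    ⁅sl2C F, sl2A F⁆ = sl2B F - sl2C F - sl2A F := by
  refine ⟨⟨?_, ?_⟩, ?_, ?_, ?_⟩
  · rw [Fintype.linearIndependent_iff]
    intro g hg
    have hM := congrArg (Subtype.val : sl (Fin 2) F → Matrix (Fin 2) (Fin 2) F) hg
    have h00 := congrFun (congrFun hM 0) 0
    have h01 := congrFun (congrFun hM 0) 1
    have h10 := congrFun (congrFun hM 1) 0
    simp [Fin.sum_univ_three, sl2A, sl2B, sl2C] at h00 h01 h10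
    intro i
    fin_cases i <;> simp <;> grind
  · rw [eq_top_iff]
    rintro M -
    have htr : Matrix.trace M.val = 0 := M.property
    rw [Matrix.trace_fin_two] at htr
    rw [Submodule.mem_span_range_iff_exists_fun]
    refine ⟨![M.val 0 0, M.val 1 0 - M.val 0 0, -M.val 0 0 - M.val 0 1], ?_⟩
    apply Subtype.ext
    ext i j
    fin_cases i <;> fin_cases j <;>
      simp [Fin.sum_univ_three, sl2A, sl2B, sl2C] <;> grind
  all_goals
    apply Subtype.ext
    ext i j
    fin_cases i <;> fin_cases j <;>
      simp [sl2A, sl2B, sl2C, Ring.lie_def]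
end
end

section
/- Consider the elements A = [[1,-1],[1,-1]], B = [[0,0],[1,0]], C = [[0,-1],[0,0]] of the Lie algebra sl_2 over F. There exists an algebra homomorphism from the Z3-symmetric down-up algebra A(2,-1,2) to the universal enveloping algebra U(sl_2) that sends A to A, B to B, and C to C. In particular, the elements A, B, C of sl_2 satisfy [A,[A,B]] = 2A, [B,[B,A]] = 2B, [B,[B,C]] = 2B, [C,[C,B]] = 2C, [C,[C,A]] = 2C, [A,[A,C]] = 2A. -/
noncomputable section

open LieAlgebra.SpecialLinear

/-- If `⁅x, ⁅x, y⁆⁆ = 2 x` in a Lie algebra, then `y x² = 2 x y x - x² y + 2 x` in its universal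
enveloping algebra. -/
theorem ι_mul_sq_of_lie_lie {R L : Type*} [CommRing R] [LieRing L] [LieAlgebra R L] {x y : L}
    (h : ⁅x, ⁅x, y⁆⁆ = (2 : R) • x) :
    UniversalEnvelopingAlgebra.ι R y * UniversalEnvelopingAlgebra.ι R x ^ 2 =
      (2 : R) • (UniversalEnvelopingAlgebra.ι R x * UniversalEnvelopingAlgebra.ι R y *
        UniversalEnvelopingAlgebra.ι R x) +
      (-1 : R) • (UniversalEnvelopingAlgebra.ι R x ^ 2 * UniversalEnvelopingAlgebra.ι R y) +
      (2 : R) • UniversalEnvelopingAlgebra.ι R x := by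
  have h' := congrArg (UniversalEnvelopingAlgebra.ι R) h
  simp only [LieHom.map_lie, map_smul, LieRing.of_associative_ring_bracket] at h'
  rw [← h', two_smul, neg_one_smul]
  noncomm_ring

/-- If `⁅x, ⁅x, y⁆⁆ = 2 x` in a Lie algebra, then `x² y = 2 x y x - y x² + 2 x` in its universal
enveloping algebra. -/
theorem ι_sq_mul_of_lie_lie {R L : Type*} [CommRing R] [LieRing L] [LieAlgebra R L] {x y : L}
    (h : ⁅x, ⁅x, y⁆⁆ = (2 : R) • x) :
    UniversalEnvelopingAlgebra.ι R x ^ 2 * UniversalEnvelopingAlgebra.ι R y =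
      (2 : R) • (UniversalEnvelopingAlgebra.ι R x * UniversalEnvelopingAlgebra.ι R y *
        UniversalEnvelopingAlgebra.ι R x) +
      (-1 : R) • (UniversalEnvelopingAlgebra.ι R y * UniversalEnvelopingAlgebra.ι R x ^ 2) +
      (2 : R) • UniversalEnvelopingAlgebra.ι R x := by
  rw [ι_mul_sq_of_lie_lie h, neg_one_smul, neg_one_smul]
  abel

/-- an algebra homomorphism `𝔸(2,-1,2) → U(sl₂)` sending `A ↦ A`, `B ↦ B`,
`C ↦ C`; in particular `A, B, C` satisfy the Z3-symmetric down-up Lie algebra relations with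
parameter `2` in `sl₂`. -/
theorem stmt12 (F : Type*) [Field F] [IsAlgClosed F] [CharZero F] :
    (∃ f : DU F 2 (-1) 2 →ₐ[F] UniversalEnvelopingAlgebra F (sl (Fin 2) F),
      f (DUgen F 2 (-1) 2 0) = UniversalEnvelopingAlgebra.ι F (sl2A F) ∧
      f (DUgen F 2 (-1) 2 1) = UniversalEnvelopingAlgebra.ι F (sl2B F) ∧
      f (DUgen F 2 (-1) 2 2) = UniversalEnvelopingAlgebra.ι F (sl2C F)) ∧
    ⁅sl2A F, ⁅sl2A F, sl2B F⁆⁆ = (2 : F) • sl2A F ∧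
    ⁅sl2B F, ⁅sl2B F, sl2A F⁆⁆ = (2 : F) • sl2B F ∧
    ⁅sl2B F, ⁅sl2B F, sl2C F⁆⁆ = (2 : F) • sl2B F ∧
    ⁅sl2C F, ⁅sl2C F, sl2B F⁆⁆ = (2 : F) • sl2C F ∧
    ⁅sl2C F, ⁅sl2C F, sl2A F⁆⁆ = (2 : F) • sl2C F ∧
    ⁅sl2A F, ⁅sl2A F, sl2C F⁆⁆ = (2 : F) • sl2A F := by
  have hAAB : ⁅sl2A F, ⁅sl2A F, sl2B F⁆⁆ = (2 : F) • sl2A F := by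
    ext i j
    fin_cases i <;> fin_cases j <;>
      simp [sl2A, sl2B, LieRing.of_associative_ring_bracket] <;> norm_num
  have hBBA : ⁅sl2B F, ⁅sl2B F, sl2A F⁆⁆ = (2 : F) • sl2B F := by
    ext i j
    fin_cases i <;> fin_cases j <;>
      simp [sl2B, sl2A, LieRing.of_associative_ring_bracket]
    norm_num
  have hBBC : ⁅sl2B F, ⁅sl2B F, sl2C F⁆⁆ = (2 : F) • sl2B F := by
    ext i j
    fin_cases i <;> fin_cases j <;>
      simp [sl2B, sl2C, LieRing.of_associative_ring_bracket]
    norm_num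
  have hCCB : ⁅sl2C F, ⁅sl2C F, sl2B F⁆⁆ = (2 : F) • sl2C F := by
    ext i j
    fin_cases i <;> fin_cases j <;>
      simp [sl2C, sl2B, LieRing.of_associative_ring_bracket]
    norm_num
  have hCCA : ⁅sl2C F, ⁅sl2C F, sl2A F⁆⁆ = (2 : F) • sl2C F := by
    ext i j
    fin_cases i <;> fin_cases j <;>
      simp [sl2C, sl2A, LieRing.of_associative_ring_bracket]
    norm_num
  have hAAC : ⁅sl2A F, ⁅sl2A F, sl2C F⁆⁆ = (2 : F) • sl2A F := by
    ext i j
    fin_cases i <;> fin_cases j <;>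
      simp [sl2A, sl2C, LieRing.of_associative_ring_bracket] <;> norm_num
  refine ⟨⟨RingQuot.liftAlgHom F ⟨FreeAlgebra.lift F
      ![UniversalEnvelopingAlgebra.ι F (sl2A F), UniversalEnvelopingAlgebra.ι F (sl2B F),
        UniversalEnvelopingAlgebra.ι F (sl2C F)], ?_⟩, ?_, ?_, ?_⟩,
    hAAB, hBBA, hBBC, hCCB, hCCA, hAAC⟩
  · rintro _ _ (_ | _ | _ | _ | _ | _) <;>
      simp only [map_add, map_mul, map_pow, map_smul, FreeAlgebra.lift_ι_apply,
        Matrix.cons_val]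
    · exact ι_mul_sq_of_lie_lie hAAB
    · exact ι_sq_mul_of_lie_lie hBBA
    · exact ι_mul_sq_of_lie_lie hBBC
    · exact ι_sq_mul_of_lie_lie hCCB
    · exact ι_mul_sq_of_lie_lie hCCA
    · exact ι_sq_mul_of_lie_lie hAAC
  all_goals simp [DUgen]
end
end

section
/- Fix xi in F with 1 + xi^3 nonzero, and consider the elements A, B, C of sl_3 given by A = [[0,1,0],[0,0,0],[0,xi,0]], B = [[0,0,xi],[0,0,1],[0,0,0]], C = [[0,0,0],[xi,0,0],[1,0,0]]. Then the eight elements A, B, C, [A,B], [B,C], [C,A], [A,[B,C]], [B,[C,A]] form a basis of the vector space sl_3. Moreover, A, B, C generate sl_3 as a Lie algebra. -/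
noncomputable section

open LieAlgebra.SpecialLinear

/-- The element `A = [[0,1,0],[0,0,0],[0,ξ,0]]` of `sl₃`. -/
def sl3A (F : Type*) [Field F] (ξ : F) : sl (Fin 3) F :=
  ⟨!![0, 1, 0; 0, 0, 0; 0, ξ, 0],
    show Matrix.trace !![(0 : F), 1, 0; 0, 0, 0; 0, ξ, 0] = 0 by
      simp [Matrix.trace_fin_three, Matrix.vecHead, Matrix.vecTail]⟩

/-- The element `B = [[0,0,ξ],[0,0,1],[0,0,0]]` of `sl₃`. -/
def sl3B (F : Type*) [Field F] (ξ : F) : sl (Fin 3) F :=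
  ⟨!![0, 0, ξ; 0, 0, 1; 0, 0, 0],
    show Matrix.trace !![(0 : F), 0, ξ; 0, 0, 1; 0, 0, 0] = 0 by
      simp [Matrix.trace_fin_three, Matrix.vecHead, Matrix.vecTail]⟩

/-- The element `C = [[0,0,0],[ξ,0,0],[1,0,0]]` of `sl₃`. -/
def sl3C (F : Type*) [Field F] (ξ : F) : sl (Fin 3) F :=
  ⟨!![0, 0, 0; ξ, 0, 0; 1, 0, 0],
    show Matrix.trace !![(0 : F), 0, 0; ξ, 0, 0; 1, 0, 0] = 0 by
      simp [Matrix.trace_fin_three, Matrix.vecHead, Matrix.vecTail]⟩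

theorem finrank_sl_fin_three (F : Type*) [Field F] :
    Module.finrank F (sl (Fin 3) F) = 8 := by
  have hsurj : Function.Surjective (Matrix.traceLinearMap (Fin 3) F F) := fun r =>
    ⟨Matrix.single 0 0 r, by simp⟩
  have h := LinearMap.finrank_range_add_finrank_ker (Matrix.traceLinearMap (Fin 3) F F)
  rw [LinearMap.range_eq_top.2 hsurj, finrank_top, Module.finrank_self,
    Module.finrank_matrix, Module.finrank_self, Fintype.card_fin] at h
  change Module.finrank F (LinearMap.ker (Matrix.traceLinearMap (Fin 3) F F)) = 8
  omega

theorem linearIndependent_sl3_brackets (F : Type*) [Field F] (ξ : F) (hξ : 1 + ξ ^ 3 ≠ 0) :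
    LinearIndependent F
      ![sl3A F ξ, sl3B F ξ, sl3C F ξ, ⁅sl3A F ξ, sl3B F ξ⁆, ⁅sl3B F ξ, sl3C F ξ⁆,
        ⁅sl3C F ξ, sl3A F ξ⁆, ⁅sl3A F ξ, ⁅sl3B F ξ, sl3C F ξ⁆⁆,
        ⁅sl3B F ξ, ⁅sl3C F ξ, sl3A F ξ⁆⁆] := by
  rw [Fintype.linearIndependent_iff]
  intro c hc
  have key (i j : Fin 3) := congrFun (congrFun (congrArg Subtype.val hc) i) j
  have e11 := key 0 0
  have e12 := key 0 1
  have e13 := key 0 2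
  have e21 := key 1 0
  have e22 := key 1 1
  have e23 := key 1 2
  have e31 := key 2 0
  have e32 := key 2 1
  simp [Fin.sum_univ_eight, sl3A, sl3B, sl3C, LieRing.of_associative_ring_bracket]
    at e11 e12 e13 e21 e22 e23 e31 e32
  clear key hc
  have hsum : c 3 + c 4 + c 5 = 0 := by
    apply (mul_eq_zero_iff_left hξ).1
    grind
  have h6 : c 6 = 0 := by grind
  have h7 : c 7 = 0 := by grind
  have h3 : c 3 = 0 := by grind
  have h4 : c 4 = 0 := by grind
  intro i
  fin_cases i <;> grind

/-- for `1 + ξ³ ≠ 0`, the eight elements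
`A, B, C, [A,B], [B,C], [C,A], [A,[B,C]], [B,[C,A]]` form a basis of `sl₃`, and
`A, B, C` generate `sl₃` as a Lie algebra. -/
theorem stmt13 (F : Type*) [Field F] [IsAlgClosed F] [CharZero F] (ξ : F)
    (hξ : 1 + ξ ^ 3 ≠ 0) :
    (LinearIndependent F
        ![sl3A F ξ, sl3B F ξ, sl3C F ξ, ⁅sl3A F ξ, sl3B F ξ⁆, ⁅sl3B F ξ, sl3C F ξ⁆,
          ⁅sl3C F ξ, sl3A F ξ⁆, ⁅sl3A F ξ, ⁅sl3B F ξ, sl3C F ξ⁆⁆,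
          ⁅sl3B F ξ, ⁅sl3C F ξ, sl3A F ξ⁆⁆] ∧
      Submodule.span F
        (Set.range
          ![sl3A F ξ, sl3B F ξ, sl3C F ξ, ⁅sl3A F ξ, sl3B F ξ⁆, ⁅sl3B F ξ, sl3C F ξ⁆,
            ⁅sl3C F ξ, sl3A F ξ⁆, ⁅sl3A F ξ, ⁅sl3B F ξ, sl3C F ξ⁆⁆,
            ⁅sl3B F ξ, ⁅sl3C F ξ, sl3A F ξ⁆⁆]) = ⊤) ∧
    LieSubalgebra.lieSpan F (sl (Fin 3) F) {sl3A F ξ, sl3B F ξ, sl3C F ξ} = ⊤ := by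
  have hli := linearIndependent_sl3_brackets F ξ hξ
  have hspan := hli.span_eq_top_of_card_eq_finrank' (by rw [finrank_sl_fin_three]; rfl)
  refine ⟨⟨hli, hspan⟩, ?_⟩
  set L := LieSubalgebra.lieSpan F (sl (Fin 3) F) {sl3A F ξ, sl3B F ξ, sl3C F ξ}
  have hA : sl3A F ξ ∈ L := LieSubalgebra.subset_lieSpan (by simp)
  have hB : sl3B F ξ ∈ L := LieSubalgebra.subset_lieSpan (by simp)
  have hC : sl3C F ξ ∈ L := LieSubalgebra.subset_lieSpan (by simp)
  rw [← LieSubalgebra.toSubmodule_inj, LieSubalgebra.top_toSubmodule, eq_top_iff, ← hspan,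
    Submodule.span_le]
  rintro _ ⟨i, rfl⟩
  fin_cases i
  exacts [hA, hB, hC, L.lie_mem hA hB, L.lie_mem hB hC, L.lie_mem hC hA,
    L.lie_mem hA (L.lie_mem hB hC), L.lie_mem hB (L.lie_mem hC hA)]
end
end

section
/- Fix xi in F and consider the elements A, B, C of sl_3 given by A = [[0,1,0],[0,0,0],[0,xi,0]], B = [[0,0,xi],[0,0,1],[0,0,0]], C = [[0,0,0],[xi,0,0],[1,0,0]]. There exists a Lie algebra homomorphism from the Z3-symmetric down-up Lie algebra L(-2*xi) to sl_3 sending A to A, B to B, C to C. Moreover, this homomorphism is surjective provided 1 + xi^3 is nonzero. -/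
noncomputable section


/-- The six defining relators of the Z3-symmetric down-up Lie algebra `𝕃(γ)`,
with generators `A = 0`, `B = 1`, `C = 2`. -/
def LieRels (F : Type*) [Field F] (γ : F) : Set (FreeLieAlgebra F (Fin 3)) :=
  let a := FreeLieAlgebra.of F (0 : Fin 3)
  let b := FreeLieAlgebra.of F (1 : Fin 3)
  let c := FreeLieAlgebra.of F (2 : Fin 3)
  {⁅a, ⁅a, b⁆⁆ - γ • a, ⁅b, ⁅b, a⁆⁆ - γ • b,
   ⁅b, ⁅b, c⁆⁆ - γ • b, ⁅c, ⁅c, b⁆⁆ - γ • c,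
   ⁅c, ⁅c, a⁆⁆ - γ • c, ⁅a, ⁅a, c⁆⁆ - γ • a}

/-- The Lie ideal of the free Lie algebra generated by the relators. -/
abbrev LieDUIdeal (F : Type*) [Field F] (γ : F) : LieIdeal F (FreeLieAlgebra F (Fin 3)) :=
  LieSubmodule.lieSpan F (FreeLieAlgebra F (Fin 3)) (LieRels F γ)

/-- The Z3-symmetric down-up Lie algebra `𝕃(γ)`. -/
abbrev LieDU (F : Type*) [Field F] (γ : F) :=
  FreeLieAlgebra F (Fin 3) ⧸ LieDUIdeal F γ

/-- The standard generators `A, B, C` of `𝕃(γ)`. -/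
def LieDUgen (F : Type*) [Field F] (γ : F) (i : Fin 3) : LieDU F γ :=
  LieSubmodule.Quotient.mk' (LieDUIdeal F γ) (FreeLieAlgebra.of F i)

open LieAlgebra.SpecialLinear

theorem sl3A_val {F : Type*} [Field F] (ξ : F) :
    (sl3A F ξ).val = !![0, 1, 0; 0, 0, 0; 0, ξ, 0] := rfl

theorem sl3B_val {F : Type*} [Field F] (ξ : F) :
    (sl3B F ξ).val = !![0, 0, ξ; 0, 0, 1; 0, 0, 0] := rfl

theorem sl3C_val {F : Type*} [Field F] (ξ : F) :
    (sl3C F ξ).val = !![0, 0, 0; ξ, 0, 0; 1, 0, 0] := rfl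

/-- The universal property of the quotient of `L` by the ideal generated by a set `s`. -/
theorem exists_lieHom_quotient_lieSpan {R L L' : Type*} [CommRing R] [LieRing L] [LieAlgebra R L]
    [LieRing L'] [LieAlgebra R L'] (s : Set L) (g : L →ₗ⁅R⁆ L') (hg : ∀ x ∈ s, g x = 0) :
    ∃ f : (L ⧸ (LieSubmodule.lieSpan R L s : LieIdeal R L)) →ₗ⁅R⁆ L',
      ∀ x, f (LieSubmodule.Quotient.mk' (LieSubmodule.lieSpan R L s : LieIdeal R L) x) = g x := by
  have hle : (LieSubmodule.lieSpan R L s : LieIdeal R L) ≤ g.ker :=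
    LieSubmodule.lieSpan_le.2 fun x hx => by simpa using hg x hx
  have hle' : (LieSubmodule.lieSpan R L s : LieIdeal R L).toSubmodule ≤
      LinearMap.ker (g : L →ₗ[R] L') := fun x hx => by simpa using hle hx
  refine ⟨{ Submodule.liftQ _ (g : L →ₗ[R] L') hle' with map_lie' := ?_ }, fun x => rfl⟩
  rintro ⟨x⟩ ⟨y⟩
  exact g.map_lie x y

/-- A Lie subalgebra of `sl₃` containing `E₁₂`, `E₂₃`, `E₃₁` and their transposes is everything. -/
theorem sl_three_eq_top_of_offDiag_mem {F : Type*} [Field F] (S : LieSubalgebra F (sl (Fin 3) F))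
    (x₁₂ x₁₃ x₂₁ x₂₃ x₃₁ x₃₂ : sl (Fin 3) F)
    (m₁₂ : x₁₂ ∈ S) (m₁₃ : x₁₃ ∈ S) (m₂₁ : x₂₁ ∈ S) (m₂₃ : x₂₃ ∈ S) (m₃₁ : x₃₁ ∈ S) (m₃₂ : x₃₂ ∈ S)
    (h₁₂ : x₁₂.val = !![0, 1, 0; 0, 0, 0; 0, 0, 0]) (h₁₃ : x₁₃.val = !![0, 0, 1; 0, 0, 0; 0, 0, 0])
    (h₂₁ : x₂₁.val = !![0, 0, 0; 1, 0, 0; 0, 0, 0]) (h₂₃ : x₂₃.val = !![0, 0, 0; 0, 0, 1; 0, 0, 0])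
    (h₃₁ : x₃₁.val = !![0, 0, 0; 0, 0, 0; 1, 0, 0]) (h₃₂ : x₃₂.val = !![0, 0, 0; 0, 0, 0; 0, 1, 0]) :
    S = ⊤ := by
  refine eq_top_iff.2 fun X _ => ?_
  have htr : X.val 0 0 + X.val 1 1 + X.val 2 2 = 0 := by
    rw [← Matrix.trace_fin_three]
    exact X.2
  have hX : X = X.val 0 1 • x₁₂ + X.val 0 2 • x₁₃ + X.val 1 0 • x₂₁ + X.val 1 2 • x₂₃ +
      X.val 2 0 • x₃₁ + X.val 2 1 • x₃₂ + X.val 0 0 • ⁅x₁₂, x₂₁⁆ +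
      (X.val 0 0 + X.val 1 1) • ⁅x₂₃, x₃₂⁆ := by
    apply Subtype.ext
    simp only [AddMemClass.coe_add, SetLike.val_smul, LieSubalgebra.coe_bracket,
      Ring.lie_def, h₁₂, h₁₃, h₂₁, h₂₃, h₃₁, h₃₂]
    ext i j
    fin_cases i <;> fin_cases j <;> simp
    linear_combination htr
  rw [hX]
  exact add_mem (add_mem (add_mem (add_mem (add_mem (add_mem (add_mem
    (S.smul_mem _ m₁₂) (S.smul_mem _ m₁₃)) (S.smul_mem _ m₂₁)) (S.smul_mem _ m₂₃))
    (S.smul_mem _ m₃₁)) (S.smul_mem _ m₃₂)) (S.smul_mem _ (S.lie_mem m₁₂ m₂₁)))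
    (S.smul_mem _ (S.lie_mem m₂₃ m₃₂))

set_option maxHeartbeats 1000000 in
/-- The elements `sl3A`, `sl3B`, `sl3C` generate `sl₃` when `1 + ξ³ ≠ 0`. -/
theorem eq_top_of_sl3A_sl3B_sl3C_mem {F : Type*} [Field F] {ξ : F} (hξ : 1 + ξ ^ 3 ≠ 0)
    (S : LieSubalgebra F (sl (Fin 3) F))
    (hA : sl3A F ξ ∈ S) (hB : sl3B F ξ ∈ S) (hC : sl3C F ξ ∈ S) : S = ⊤ := by
  have key : ∀ x y z : sl (Fin 3) F, x ∈ S → y ∈ S → z ∈ S →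
      ((1 + ξ ^ 3) ^ 2)⁻¹ • (⁅x, y⁆ + ξ ^ 3 • ⁅y, z⁆ + ξ • ⁅y, ⁅z, x⁆⁆ +
        ((1 + ξ ^ 3) * ξ ^ 2) • y) ∈ S := fun x y z hx hy hz =>
    S.smul_mem _ (add_mem (add_mem (add_mem (S.lie_mem hx hy) (S.smul_mem _ (S.lie_mem hy hz)))
      (S.smul_mem _ (S.lie_mem hy (S.lie_mem hz hx)))) (S.smul_mem _ hy))
  obtain ⟨u, hu, hu'⟩ : ∃ u ∈ S, u.val = !![0, 0, 0; 0, 0, 0; 0, 1, 0] := by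
    refine ⟨_, key _ _ _ hC hA hB, ?_⟩
    simp only [AddMemClass.coe_add, SetLike.val_smul, LieSubalgebra.coe_bracket,
      Ring.lie_def, sl3A_val, sl3B_val, sl3C_val]
    rw [inv_smul_eq_iff₀ (pow_ne_zero 2 hξ)]
    ext i j
    fin_cases i <;> fin_cases j <;> simp <;> ring
  obtain ⟨v, hv, hv'⟩ : ∃ v ∈ S, v.val = !![0, 0, 1; 0, 0, 0; 0, 0, 0] := by
    refine ⟨_, key _ _ _ hA hB hC, ?_⟩
    simp only [AddMemClass.coe_add, SetLike.val_smul, LieSubalgebra.coe_bracket,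
      Ring.lie_def, sl3A_val, sl3B_val, sl3C_val]
    rw [inv_smul_eq_iff₀ (pow_ne_zero 2 hξ)]
    ext i j
    fin_cases i <;> fin_cases j <;> simp <;> ring
  obtain ⟨w, hw, hw'⟩ : ∃ w ∈ S, w.val = !![0, 0, 0; 1, 0, 0; 0, 0, 0] := by
    refine ⟨_, key _ _ _ hB hC hA, ?_⟩
    simp only [AddMemClass.coe_add, SetLike.val_smul, LieSubalgebra.coe_bracket,
      Ring.lie_def, sl3A_val, sl3B_val, sl3C_val]
    rw [inv_smul_eq_iff₀ (pow_ne_zero 2 hξ)]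
    ext i j
    fin_cases i <;> fin_cases j <;> simp <;> ring
  refine sl_three_eq_top_of_offDiag_mem S (sl3A F ξ - ξ • u) v w (sl3B F ξ - ξ • v)
    (sl3C F ξ - ξ • w) u (sub_mem hA (S.smul_mem _ hu)) hv hw (sub_mem hB (S.smul_mem _ hv))
    (sub_mem hC (S.smul_mem _ hw)) hu ?_ hv' hw' ?_ ?_ hu'
  all_goals
    simp only [AddSubgroupClass.coe_sub, SetLike.val_smul, hu', hv', hw', sl3A_val, sl3B_val, sl3C_val]
    ext i j
    fin_cases i <;> fin_cases j <;> simp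

set_option maxHeartbeats 1000000 in
/-- The elements `sl3A`, `sl3B`, `sl3C` satisfy the defining relations of `𝕃(-2ξ)`. -/
theorem lift_sl3_eq_zero_of_mem_lieRels {F : Type*} [Field F] (ξ : F)
    (x : FreeLieAlgebra F (Fin 3)) (hx : x ∈ LieRels F (-(2 * ξ))) :
    FreeLieAlgebra.lift F ![sl3A F ξ, sl3B F ξ, sl3C F ξ] x = 0 := by
  simp only [LieRels, Set.mem_insert_iff, Set.mem_singleton_iff] at hx
  rcases hx with rfl | rfl | rfl | rfl | rfl | rfl
  all_goals
    simp only [map_sub, map_smul, LieHom.map_lie, FreeLieAlgebra.lift_of_apply,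
      Matrix.cons_val]
    apply Subtype.ext
    simp only [AddSubgroupClass.coe_sub, SetLike.val_smul, LieSubalgebra.coe_bracket,
      ZeroMemClass.coe_zero, Ring.lie_def, sl3A_val, sl3B_val, sl3C_val]
    ext i j
    fin_cases i <;> fin_cases j <;> simp <;> ring

/-- a Lie algebra homomorphism `𝕃(-2ξ) → sl₃` sending `A ↦ A`, `B ↦ B`,
`C ↦ C`, surjective whenever `1 + ξ³ ≠ 0`. -/
theorem stmt14 (F : Type*) [Field F] [IsAlgClosed F] [CharZero F] (ξ : F) :
    ∃ f : LieDU F (-(2 * ξ)) →ₗ⁅F⁆ sl (Fin 3) F,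
      f (LieDUgen F (-(2 * ξ)) 0) = sl3A F ξ ∧
      f (LieDUgen F (-(2 * ξ)) 1) = sl3B F ξ ∧
      f (LieDUgen F (-(2 * ξ)) 2) = sl3C F ξ ∧
      (1 + ξ ^ 3 ≠ 0 → Function.Surjective f) := by
  obtain ⟨f, hf⟩ := exists_lieHom_quotient_lieSpan (LieRels F (-(2 * ξ))) _
    (lift_sl3_eq_zero_of_mem_lieRels ξ)
  have hA : f (LieDUgen F (-(2 * ξ)) 0) = sl3A F ξ := (hf _).trans (by simp)
  have hB : f (LieDUgen F (-(2 * ξ)) 1) = sl3B F ξ := (hf _).trans (by simp)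
  have hC : f (LieDUgen F (-(2 * ξ)) 2) = sl3C F ξ := (hf _).trans (by simp)
  refine ⟨f, hA, hB, hC, fun hξ => ?_⟩
  rw [← LieHom.range_eq_top]
  exact eq_top_of_sl3A_sl3B_sl3C_mem hξ f.range (f.mem_range _ |>.2 ⟨_, hA⟩)
    (f.mem_range _ |>.2 ⟨_, hB⟩) (f.mem_range _ |>.2 ⟨_, hC⟩)
end
end

section
/- Fix xi in F and consider the elements A, B, C of sl_3 given by A = [[0,1,0],[0,0,0],[0,xi,0]], B = [[0,0,xi],[0,0,1],[0,0,0]], C = [[0,0,0],[xi,0,0],[1,0,0]]. There exists an algebra homomorphism from the Z3-symmetric down-up algebra A(2,-1,-2*xi) to the universal enveloping algebra U(sl_3) sending A to A, B to B, C to C. Moreover, this homomorphism is surjective provided 1 + xi^3 is nonzero. -/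
noncomputable section

open LieAlgebra.SpecialLinear

section

attribute [local instance] LieRing.ofAssociativeRing

namespace UniversalEnvelopingAlgebra

variable {R L : Type*} [CommRing R] [LieRing L] [LieAlgebra R L]

theorem ι_lie (x y : L) : ι R ⁅x, y⁆ = ι R x * ι R y - ι R y * ι R x := by
  rw [LieHom.map_lie, LieRing.of_associative_ring_bracket]

theorem mkAlgHom_surjective : Function.Surjective (mkAlgHom R L) :=
  RingCon.mkₐ_surjective (ringCon R L)

theorem adjoin_range_ι : Algebra.adjoin R (Set.range (ι R : L → _)) = ⊤ := by
  have h : Set.range (ι R : L → _) = mkAlgHom R L '' Set.range (TensorAlgebra.ι R) :=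
    Set.range_comp (mkAlgHom R L) (TensorAlgebra.ι R)
  rw [h, ← AlgHom.map_adjoin, TensorAlgebra.adjoin_range_ι, Algebra.map_top,
    AlgHom.range_eq_top]
  exact mkAlgHom_surjective

/-- A subalgebra of the enveloping algebra restricts to a Lie subalgebra of `L`. -/
def comapι (S : Subalgebra R (UniversalEnvelopingAlgebra R L)) : LieSubalgebra R L where
  toSubmodule := S.toSubmodule.comap (ι R : L →ₗ⁅R⁆ _).toLinearMap
  lie_mem' {x y} hx hy := by
    change ι R ⁅x, y⁆ ∈ S
    rw [ι_lie]
    exact S.sub_mem (S.mul_mem hx hy) (S.mul_mem hy hx)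

/-- A subalgebra containing the image of a Lie generating set is everything. -/
theorem eq_top_of_lieSpan_eq_top {s : Set L} (hs : LieSubalgebra.lieSpan R L s = ⊤)
    {S : Subalgebra R (UniversalEnvelopingAlgebra R L)} (h : ∀ x ∈ s, ι R x ∈ S) : S = ⊤ := by
  have hle : LieSubalgebra.lieSpan R L s ≤ comapι S := LieSubalgebra.lieSpan_le.2 h
  rw [hs] at hle
  rw [← top_le_iff, ← adjoin_range_ι, Algebra.adjoin_le_iff]
  rintro _ ⟨x, rfl⟩
  exact hle (LieSubalgebra.mem_top x)

theorem ι_mul_ι_sq {x y : L} {c : R} (h : ⁅x, ⁅x, y⁆⁆ = c • x) :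
    ι R y * ι R x ^ 2 =
      (2 : R) • (ι R x * ι R y * ι R x) + (-1 : R) • (ι R x ^ 2 * ι R y) + c • ι R x := by
  rw [← map_smul, ← h, ι_lie, ι_lie, two_smul, neg_one_smul]
  noncomm_ring

theorem ι_sq_mul_ι {x y : L} {c : R} (h : ⁅x, ⁅x, y⁆⁆ = c • x) :
    ι R x ^ 2 * ι R y =
      (2 : R) • (ι R x * ι R y * ι R x) + (-1 : R) • (ι R y * ι R x ^ 2) + c • ι R x := by
  rw [ι_mul_ι_sq h, two_smul, neg_one_smul, neg_one_smul]
  abel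

end UniversalEnvelopingAlgebra

end

section SpecialLinear

variable {F : Type*} [Field F] (ξ : F)

theorem val_sl3A : (sl3A F ξ).val = !![0, 1, 0; 0, 0, 0; 0, ξ, 0] := rfl

theorem val_sl3B : (sl3B F ξ).val = !![0, 0, ξ; 0, 0, 1; 0, 0, 0] := rfl

theorem val_sl3C : (sl3C F ξ).val = !![0, 0, 0; ξ, 0, 0; 1, 0, 0] := rfl

theorem lie_sl3A_sl3A_sl3B : ⁅sl3A F ξ, ⁅sl3A F ξ, sl3B F ξ⁆⁆ = (-(2 * ξ)) • sl3A F ξ := by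
  ext i j
  fin_cases i <;> fin_cases j <;>
    simp [LieRing.of_associative_ring_bracket, val_sl3A, val_sl3B] <;> ring

theorem lie_sl3B_sl3B_sl3A : ⁅sl3B F ξ, ⁅sl3B F ξ, sl3A F ξ⁆⁆ = (-(2 * ξ)) • sl3B F ξ := by
  ext i j
  fin_cases i <;> fin_cases j <;>
    simp [LieRing.of_associative_ring_bracket, val_sl3A, val_sl3B] <;> ring

theorem lie_sl3B_sl3B_sl3C : ⁅sl3B F ξ, ⁅sl3B F ξ, sl3C F ξ⁆⁆ = (-(2 * ξ)) • sl3B F ξ := by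
  ext i j
  fin_cases i <;> fin_cases j <;>
    simp [LieRing.of_associative_ring_bracket, val_sl3B, val_sl3C] <;> ring

theorem lie_sl3C_sl3C_sl3B : ⁅sl3C F ξ, ⁅sl3C F ξ, sl3B F ξ⁆⁆ = (-(2 * ξ)) • sl3C F ξ := by
  ext i j
  fin_cases i <;> fin_cases j <;>
    simp [LieRing.of_associative_ring_bracket, val_sl3B, val_sl3C] <;> ring

theorem lie_sl3C_sl3C_sl3A : ⁅sl3C F ξ, ⁅sl3C F ξ, sl3A F ξ⁆⁆ = (-(2 * ξ)) • sl3C F ξ := by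
  ext i j
  fin_cases i <;> fin_cases j <;>
    simp [LieRing.of_associative_ring_bracket, val_sl3A, val_sl3C] <;> ring

theorem lie_sl3A_sl3A_sl3C : ⁅sl3A F ξ, ⁅sl3A F ξ, sl3C F ξ⁆⁆ = (-(2 * ξ)) • sl3A F ξ := by
  ext i j
  fin_cases i <;> fin_cases j <;>
    simp [LieRing.of_associative_ring_bracket, val_sl3A, val_sl3C] <;> ring

theorem lie_single_single {i j : Fin 3} (h : i ≠ j) :
    ⁅single i j h (1 : F), single j i h.symm (1 : F)⁆ = singleSubSingle i j (1 : F) := by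
  ext : 1
  simp [LieRing.of_associative_ring_bracket]

/-- A Lie subalgebra of `sl₃` containing all off-diagonal matrix units is everything. -/
theorem LieSubalgebra.eq_top_of_single_mem {K : LieSubalgebra F (sl (Fin 3) F)}
    (h : ∀ (i j : Fin 3) (hij : i ≠ j), single i j hij (1 : F) ∈ K) : K = ⊤ := by
  rw [← top_le_iff]
  intro M _
  have htr : M.val 0 0 + M.val 1 1 + M.val 2 2 = 0 := by
    rw [← Matrix.trace_fin_three]
    exact M.2
  have hM : M = M.val 0 1 • single 0 1 (by decide) 1 + M.val 0 2 • single 0 2 (by decide) 1 +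
      M.val 1 0 • single 1 0 (by decide) 1 + M.val 1 2 • single 1 2 (by decide) 1 +
      M.val 2 0 • single 2 0 (by decide) 1 + M.val 2 1 • single 2 1 (by decide) 1 +
      M.val 0 0 • singleSubSingle 0 1 1 -
      M.val 2 2 • singleSubSingle 1 2 1 := by
    ext i j
    fin_cases i <;> fin_cases j <;> simp
    linear_combination htr
  rw [hM]
  have hs (i j : Fin 3) (hij : i ≠ j) (c : F) : c • single i j hij (1 : F) ∈ K :=
    K.smul_mem c (h i j hij)
  have hd (i j : Fin 3) (hij : i ≠ j) (c : F) : c • singleSubSingle i j (1 : F) ∈ K := by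
    rw [← lie_single_single hij]
    exact K.smul_mem c (K.lie_mem (h ..) (h ..))
  exact K.sub_mem (K.add_mem (K.add_mem (K.add_mem (K.add_mem (K.add_mem (K.add_mem
    (hs ..) (hs ..)) (hs ..)) (hs ..)) (hs ..)) (hs ..))
    (hd 0 1 (by decide) _)) (hd 1 2 (by decide) _)

theorem smul_single_two_one_eq : (1 + ξ ^ 3) ^ 2 • single 2 1 (by decide) (1 : F) =
    ξ • ⁅sl3A F ξ, ⁅sl3B F ξ, sl3C F ξ⁆⁆ + ξ ^ 3 • ⁅sl3A F ξ, sl3B F ξ⁆ + ⁅sl3C F ξ, sl3A F ξ⁆ +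
      (ξ ^ 5 + ξ ^ 2) • sl3A F ξ := by
  ext i j
  fin_cases i <;> fin_cases j <;>
    simp [LieRing.of_associative_ring_bracket, val_sl3A, val_sl3B, val_sl3C] <;> ring

theorem smul_single_zero_two_eq : (1 + ξ ^ 3) ^ 2 • single 0 2 (by decide) (1 : F) =
    ξ • ⁅sl3B F ξ, ⁅sl3C F ξ, sl3A F ξ⁆⁆ + ξ ^ 3 • ⁅sl3B F ξ, sl3C F ξ⁆ + ⁅sl3A F ξ, sl3B F ξ⁆ +
      (ξ ^ 5 + ξ ^ 2) • sl3B F ξ := by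
  ext i j
  fin_cases i <;> fin_cases j <;>
    simp [LieRing.of_associative_ring_bracket, val_sl3A, val_sl3B, val_sl3C] <;> ring

theorem smul_single_one_zero_eq : (1 + ξ ^ 3) ^ 2 • single 1 0 (by decide) (1 : F) =
    ξ • ⁅sl3C F ξ, ⁅sl3A F ξ, sl3B F ξ⁆⁆ + ξ ^ 3 • ⁅sl3C F ξ, sl3A F ξ⁆ + ⁅sl3B F ξ, sl3C F ξ⁆ +
      (ξ ^ 5 + ξ ^ 2) • sl3C F ξ := by
  ext i j
  fin_cases i <;> fin_cases j <;>
    simp [LieRing.of_associative_ring_bracket, val_sl3A, val_sl3B, val_sl3C] <;> ring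

theorem lieSpan_sl3_eq_top (hξ : 1 + ξ ^ 3 ≠ 0) :
    LieSubalgebra.lieSpan F (sl (Fin 3) F) {sl3A F ξ, sl3B F ξ, sl3C F ξ} = ⊤ := by
  set K := LieSubalgebra.lieSpan F (sl (Fin 3) F) {sl3A F ξ, sl3B F ξ, sl3C F ξ}
  have hA : sl3A F ξ ∈ K := LieSubalgebra.subset_lieSpan (by simp)
  have hB : sl3B F ξ ∈ K := LieSubalgebra.subset_lieSpan (by simp)
  have hC : sl3C F ξ ∈ K := LieSubalgebra.subset_lieSpan (by simp)
  have comb {x y z : sl (Fin 3) F} (hx : x ∈ K) (hy : y ∈ K) (hz : z ∈ K) :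
      ξ • ⁅x, ⁅y, z⁆⁆ + ξ ^ 3 • ⁅x, y⁆ + ⁅z, x⁆ + (ξ ^ 5 + ξ ^ 2) • x ∈ K :=
    K.add_mem (K.add_mem (K.add_mem (K.smul_mem _ (K.lie_mem hx (K.lie_mem hy hz)))
      (K.smul_mem _ (K.lie_mem hx hy))) (K.lie_mem hz hx)) (K.smul_mem _ hx)
  have cancel {x : sl (Fin 3) F} (hx : (1 + ξ ^ 3) ^ 2 • x ∈ K) : x ∈ K :=
    (K.toSubmodule.smul_mem_iff (pow_ne_zero 2 hξ)).1 hx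
  have h21 : single 2 1 (by decide) (1 : F) ∈ K := by
    apply cancel
    rw [smul_single_two_one_eq]
    exact comb hA hB hC
  have h02 : single 0 2 (by decide) (1 : F) ∈ K := by
    apply cancel
    rw [smul_single_zero_two_eq]
    exact comb hB hC hA
  have h10 : single 1 0 (by decide) (1 : F) ∈ K := by
    apply cancel
    rw [smul_single_one_zero_eq]
    exact comb hC hA hB
  have h01 : single 0 1 (by decide) (1 : F) ∈ K := by
    convert K.sub_mem hA (K.smul_mem ξ h21) using 1
    ext i j
    fin_cases i <;> fin_cases j <;> simp [val_sl3A]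
  have h12 : single 1 2 (by decide) (1 : F) ∈ K := by
    convert K.sub_mem hB (K.smul_mem ξ h02) using 1
    ext i j
    fin_cases i <;> fin_cases j <;> simp [val_sl3B]
  have h20 : single 2 0 (by decide) (1 : F) ∈ K := by
    convert K.sub_mem hC (K.smul_mem ξ h10) using 1
    ext i j
    fin_cases i <;> fin_cases j <;> simp [val_sl3C]
  refine LieSubalgebra.eq_top_of_single_mem fun i j hij => ?_
  fin_cases i <;> fin_cases j <;> first | exact absurd rfl hij | assumption

end SpecialLinear

/-- an algebra homomorphism `𝔸(2,-1,-2ξ) → U(sl₃)` sending `A ↦ A`, `B ↦ B`,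
`C ↦ C`, surjective whenever `1 + ξ³ ≠ 0`. -/
theorem stmt15 (F : Type*) [Field F] [IsAlgClosed F] [CharZero F] (ξ : F) :
    ∃ f : DU F 2 (-1) (-(2 * ξ)) →ₐ[F] UniversalEnvelopingAlgebra F (sl (Fin 3) F),
      f (DUgen F 2 (-1) (-(2 * ξ)) 0) = UniversalEnvelopingAlgebra.ι F (sl3A F ξ) ∧
      f (DUgen F 2 (-1) (-(2 * ξ)) 1) = UniversalEnvelopingAlgebra.ι F (sl3B F ξ) ∧
      f (DUgen F 2 (-1) (-(2 * ξ)) 2) = UniversalEnvelopingAlgebra.ι F (sl3C F ξ) ∧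
      (1 + ξ ^ 3 ≠ 0 → Function.Surjective f) := by
  set a := UniversalEnvelopingAlgebra.ι F (sl3A F ξ)
  set b := UniversalEnvelopingAlgebra.ι F (sl3B F ξ)
  set c := UniversalEnvelopingAlgebra.ι F (sl3C F ξ)
  have hrel ⦃x y⦄ (h : DURel F 2 (-1) (-(2 * ξ)) x y) :
      FreeAlgebra.lift F ![a, b, c] x = FreeAlgebra.lift F ![a, b, c] y := by
    cases h <;> simp only [map_add, map_mul, map_smul, map_pow, FreeAlgebra.lift_ι_apply]
    · exact UniversalEnvelopingAlgebra.ι_mul_ι_sq (lie_sl3A_sl3A_sl3B ξ)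
    · exact UniversalEnvelopingAlgebra.ι_sq_mul_ι (lie_sl3B_sl3B_sl3A ξ)
    · exact UniversalEnvelopingAlgebra.ι_mul_ι_sq (lie_sl3B_sl3B_sl3C ξ)
    · exact UniversalEnvelopingAlgebra.ι_sq_mul_ι (lie_sl3C_sl3C_sl3B ξ)
    · exact UniversalEnvelopingAlgebra.ι_mul_ι_sq (lie_sl3C_sl3C_sl3A ξ)
    · exact UniversalEnvelopingAlgebra.ι_sq_mul_ι (lie_sl3A_sl3A_sl3C ξ)
  let f := RingQuot.liftAlgHom F ⟨FreeAlgebra.lift F ![a, b, c], hrel⟩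
  have hf (i : Fin 3) : f (DUgen F 2 (-1) (-(2 * ξ)) i) = ![a, b, c] i :=
    (RingQuot.liftAlgHom_mkAlgHom_apply F _ hrel _).trans (FreeAlgebra.lift_ι_apply _ i)
  refine ⟨f, hf 0, hf 1, hf 2, fun hξ => ?_⟩
  rw [← AlgHom.range_eq_top]
  refine UniversalEnvelopingAlgebra.eq_top_of_lieSpan_eq_top (lieSpan_sl3_eq_top ξ hξ) ?_
  rintro _ (rfl | rfl | rfl)
  exacts [⟨_, hf 0⟩, ⟨_, hf 1⟩, ⟨_, hf 2⟩]
end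
end

section
/- Fix a nonzero q in F. For theta in F, the vector space W_q(theta) (the Z3-symmetric q-Weyl algebra with parameter theta) has a basis consisting of the monomials A^i B^j C^k for i, j, k natural numbers. -/
noncomputable section

/-- The defining relations `AB - q·BA = θ`, `BC - q·CB = θ`, `CA - q·AC = θ` of the
Z3-symmetric q-Weyl algebra, with `A = 0`, `B = 1`, `C = 2`. -/
inductive Wq3Rel (F : Type*) [Field F] (q θ : F) :
    FreeAlgebra F (Fin 3) → FreeAlgebra F (Fin 3) → Prop
  | r1 : Wq3Rel F q θ (XX F 0 * XX F 1) (q • (XX F 1 * XX F 0) + algebraMap F _ θ)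
  | r2 : Wq3Rel F q θ (XX F 1 * XX F 2) (q • (XX F 2 * XX F 1) + algebraMap F _ θ)
  | r3 : Wq3Rel F q θ (XX F 2 * XX F 0) (q • (XX F 0 * XX F 2) + algebraMap F _ θ)

/-- The Z3-symmetric q-Weyl algebra `𝕎_q(θ)`. -/
abbrev Wq3 (F : Type*) [Field F] (q θ : F) := RingQuot (Wq3Rel F q θ)

/-- The standard generators `A, B, C` of the Z3-symmetric q-Weyl algebra. -/
def Wq3gen (F : Type*) [Field F] (q θ : F) (i : Fin 3) : Wq3 F q θ :=
  RingQuot.mkAlgHom F (Wq3Rel F q θ) (XX F i)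

namespace Wq3

section Relations

variable (F : Type*) [Field F] (q θ : F)

theorem gen_zero_mul_one : Wq3gen F q θ 0 * Wq3gen F q θ 1 =
    q • (Wq3gen F q θ 1 * Wq3gen F q θ 0) + algebraMap F _ θ := by
  simpa [Wq3gen] using RingQuot.mkAlgHom_rel F (Wq3Rel.r1 (F := F) (q := q) (θ := θ))

theorem gen_one_mul_two : Wq3gen F q θ 1 * Wq3gen F q θ 2 =
    q • (Wq3gen F q θ 2 * Wq3gen F q θ 1) + algebraMap F _ θ := by
  simpa [Wq3gen] using RingQuot.mkAlgHom_rel F (Wq3Rel.r2 (F := F) (q := q) (θ := θ))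

theorem gen_two_mul_zero : Wq3gen F q θ 2 * Wq3gen F q θ 0 =
    q • (Wq3gen F q θ 0 * Wq3gen F q θ 2) + algebraMap F _ θ := by
  simpa [Wq3gen] using RingQuot.mkAlgHom_rel F (Wq3Rel.r3 (F := F) (q := q) (θ := θ))

end Relations

section Span

variable {F : Type*} [Field F] {W : Type*} [Ring W] [Algebra F W]

/-- The span of the ordered monomials `a ^ i * b ^ j * c ^ k`. -/
def monomialSpan (F : Type*) [Field F] {W : Type*} [Ring W] [Algebra F W] (a b c : W) :
    Submodule F W :=
  Submodule.span F (Set.range fun p : ℕ × ℕ × ℕ => a ^ p.1 * b ^ p.2.1 * c ^ p.2.2)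

variable {a b c : W} {q θ : F}

theorem monomial_mem (i j k : ℕ) : a ^ i * b ^ j * c ^ k ∈ monomialSpan F a b c :=
  Submodule.subset_span ⟨(i, j, k), rfl⟩

theorem mul_mem_monomialSpan_of_monomial {x : W}
    (h : ∀ i j k : ℕ, x * (a ^ i * b ^ j * c ^ k) ∈ monomialSpan F a b c) {s : W}
    (hs : s ∈ monomialSpan F a b c) : x * s ∈ monomialSpan F a b c := by
  have : monomialSpan F a b c ≤ (monomialSpan F a b c).comap (LinearMap.mulLeft F x) := by
    refine Submodule.span_le.2 ?_
    rintro _ ⟨⟨i, j, k⟩, rfl⟩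
    exact h i j k
  exact this hs

theorem left_mul_mem {s : W} (hs : s ∈ monomialSpan F a b c) :
    a * s ∈ monomialSpan F a b c := by
  refine mul_mem_monomialSpan_of_monomial (fun i j k => ?_) hs
  have h := monomial_mem (F := F) (a := a) (b := b) (c := c) (i + 1) j k
  rwa [pow_succ', mul_assoc a, mul_assoc a] at h

theorem mul_eq_of_rel (hq : q ≠ 0) {x y : W} (h : x * y = q • (y * x) + algebraMap F W θ) :
    y * x = q⁻¹ • (x * y - algebraMap F W θ) := by
  rw [h, add_sub_cancel_right, smul_smul, inv_mul_cancel₀ hq, one_smul]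

theorem middle_mul_mem (hq : q ≠ 0) (hab : a * b = q • (b * a) + algebraMap F W θ) {s : W}
    (hs : s ∈ monomialSpan F a b c) : b * s ∈ monomialSpan F a b c := by
  refine mul_mem_monomialSpan_of_monomial (fun i j k => ?_) hs
  induction i with
  | zero =>
    have h := monomial_mem (F := F) (a := a) (b := b) (c := c) 0 (j + 1) k
    simpa [pow_succ', mul_assoc] using h
  | succ i ih =>
    have e : b * (a ^ (i + 1) * b ^ j * c ^ k) = q⁻¹ • (a * (b * (a ^ i * b ^ j * c ^ k)) -
        θ • (a ^ i * b ^ j * c ^ k)) := by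
      rw [pow_succ', mul_assoc a, mul_assoc a, ← mul_assoc b a, mul_eq_of_rel hq hab,
        smul_mul_assoc, sub_mul, mul_assoc a b, Algebra.smul_def θ]
    rw [e]
    exact Submodule.smul_mem _ _
      (Submodule.sub_mem _ (left_mul_mem ih) (Submodule.smul_mem _ _ (monomial_mem i j k)))

theorem right_mul_mem (hq : q ≠ 0) (hab : a * b = q • (b * a) + algebraMap F W θ)
    (hbc : b * c = q • (c * b) + algebraMap F W θ)
    (hca : c * a = q • (a * c) + algebraMap F W θ) {s : W}
    (hs : s ∈ monomialSpan F a b c) : c * s ∈ monomialSpan F a b c := by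
  refine mul_mem_monomialSpan_of_monomial (fun i j k => ?_) hs
  induction i with
  | zero =>
    have h0 (j : ℕ) : b ^ j * c ^ k ∈ monomialSpan F a b c := by
      simpa using monomial_mem (F := F) (a := a) (b := b) (c := c) 0 j k
    rw [pow_zero, one_mul]
    induction j with
    | zero =>
      have h := monomial_mem (F := F) (a := a) (b := b) (c := c) 0 0 (k + 1)
      simpa [pow_succ'] using h
    | succ j ih =>
      have e : c * (b ^ (j + 1) * c ^ k) = q⁻¹ • (b * (c * (b ^ j * c ^ k)) -
          θ • (b ^ j * c ^ k)) := by
        rw [pow_succ', mul_assoc b, ← mul_assoc c b, mul_eq_of_rel hq hbc,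
          smul_mul_assoc, sub_mul, mul_assoc b c, Algebra.smul_def θ]
      rw [e]
      exact Submodule.smul_mem _ _
        (Submodule.sub_mem _ (middle_mul_mem hq hab ih) (Submodule.smul_mem _ _ (h0 j)))
  | succ i ih =>
    have e : c * (a ^ (i + 1) * b ^ j * c ^ k) = q • (a * (c * (a ^ i * b ^ j * c ^ k))) +
        θ • (a ^ i * b ^ j * c ^ k) := by
      rw [pow_succ', mul_assoc a, mul_assoc a, ← mul_assoc c a, hca,
        add_mul, smul_mul_assoc, mul_assoc a c, Algebra.smul_def θ]
    rw [e]
    exact Submodule.add_mem _ (Submodule.smul_mem _ _ (left_mul_mem ih))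
      (Submodule.smul_mem _ _ (monomial_mem i j k))

theorem monomialSpan_gen_eq_top (hq : q ≠ 0) :
    monomialSpan F (Wq3gen F q θ 0) (Wq3gen F q θ 1) (Wq3gen F q θ 2) = ⊤ := by
  set S := monomialSpan F (Wq3gen F q θ 0) (Wq3gen F q θ 1) (Wq3gen F q θ 2) with hS
  have key (x : FreeAlgebra F (Fin 3)) :
      ∀ s ∈ S, RingQuot.mkAlgHom F (Wq3Rel F q θ) x * s ∈ S := by
    induction x using FreeAlgebra.induction with
    | grade0 r =>
      intro s hs
      rw [AlgHom.commutes, ← Algebra.smul_def]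
      exact S.smul_mem r hs
    | grade1 i =>
      intro s hs
      have hab := gen_zero_mul_one F q θ
      fin_cases i
      · exact left_mul_mem hs
      · exact middle_mul_mem hq hab hs
      · exact right_mul_mem hq hab (gen_one_mul_two F q θ) (gen_two_mul_zero F q θ) hs
    | mul x y hx hy =>
      intro s hs
      rw [map_mul, mul_assoc]
      exact hx _ (hy s hs)
    | add x y hx hy =>
      intro s hs
      rw [map_add, add_mul]
      exact S.add_mem (hx s hs) (hy s hs)
  have one_mem : (1 : Wq3 F q θ) ∈ S := by
    simpa using monomial_mem (F := F) (a := Wq3gen F q θ 0) (b := Wq3gen F q θ 1)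
      (c := Wq3gen F q θ 2) 0 0 0
  refine Submodule.eq_top_iff'.2 fun w => ?_
  obtain ⟨x, rfl⟩ := RingQuot.mkAlgHom_surjective F (Wq3Rel F q θ) w
  simpa using key x 1 one_mem

end Span

section Representation

variable {F : Type*} [Field F]

/-- The vector space with basis the formal ordered monomials. -/
abbrev Monomials (F : Type*) [Field F] := ℕ × ℕ × ℕ →₀ F

/-- The formal ordered monomial with exponents `i`, `j`, `k`. -/
abbrev mono (F : Type*) [Field F] (i j k : ℕ) : Monomials F := Finsupp.single (i, j, k) 1

/-- The solution of `u 0 = 0`, `u (n + 1) = r * u n + 1`. -/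
def qNat (r : F) : ℕ → F
  | 0 => 0
  | n + 1 => r * qNat r n + 1

/-- Left multiplication by `A` on formal ordered monomials. -/
def opA (F : Type*) [Field F] : Module.End F (Monomials F) :=
  Finsupp.linearCombination F fun p => mono F (p.1 + 1) p.2.1 p.2.2

/-- Left multiplication by `B` on formal ordered monomials. -/
def opB (q θ : F) : Module.End F (Monomials F) :=
  Finsupp.linearCombination F fun p =>
    q⁻¹ ^ p.1 • mono F p.1 (p.2.1 + 1) p.2.2 -
      (θ * (q⁻¹ * qNat q⁻¹ p.1)) • mono F (p.1 - 1) p.2.1 p.2.2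

/-- Left multiplication by `C` on formal ordered monomials. -/
def opC (q θ : F) : Module.End F (Monomials F) :=
  Finsupp.linearCombination F fun p =>
    q ^ p.1 • (q⁻¹ ^ p.2.1 • mono F p.1 p.2.1 (p.2.2 + 1) -
      (θ * (q⁻¹ * qNat q⁻¹ p.2.1)) • mono F p.1 (p.2.1 - 1) p.2.2) +
      (θ * qNat q p.1) • mono F (p.1 - 1) p.2.1 p.2.2

theorem opA_mono (i j k : ℕ) : opA F (mono F i j k) = mono F (i + 1) j k := by
  simp [opA]

theorem opB_mono (q θ : F) (i j k : ℕ) : opB q θ (mono F i j k) =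
    q⁻¹ ^ i • mono F i (j + 1) k - (θ * (q⁻¹ * qNat q⁻¹ i)) • mono F (i - 1) j k := by
  rw [opB, Finsupp.linearCombination_single, one_smul]

theorem opC_mono (q θ : F) (i j k : ℕ) : opC q θ (mono F i j k) =
    q ^ i • (q⁻¹ ^ j • mono F i j (k + 1) -
      (θ * (q⁻¹ * qNat q⁻¹ j)) • mono F i (j - 1) k) +
      (θ * qNat q i) • mono F (i - 1) j k := by
  rw [opC, Finsupp.linearCombination_single, one_smul]

theorem end_ext {f g : Module.End F (Monomials F)}
    (h : ∀ i j k, f (mono F i j k) = g (mono F i j k)) : f = g :=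
  Finsupp.lhom_ext' fun ⟨i, j, k⟩ => LinearMap.ext_ring (h i j k)

variable {q : F}

theorem opA_mul_opB (hq : q ≠ 0) (θ : F) :
    opA F * opB q θ = q • (opB q θ * opA F) + algebraMap F _ θ := by
  refine end_ext fun i j k => ?_
  cases i <;>
  · simp only [Module.End.mul_apply, LinearMap.add_apply, LinearMap.smul_apply,
      Module.algebraMap_end_apply, opA_mono, opB_mono, map_sub, map_smul, qNat, pow_succ,
      Nat.add_sub_cancel, zero_add]
    match_scalars <;> field_simp <;> ring

theorem opC_mul_opA (θ : F) :
    opC q θ * opA F = q • (opA F * opC q θ) + algebraMap F _ θ := by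
  refine end_ext fun i j k => ?_
  cases i <;>
  · simp only [Module.End.mul_apply, LinearMap.add_apply, LinearMap.smul_apply,
      Module.algebraMap_end_apply, opA_mono, opC_mono, map_add, map_sub, map_smul, qNat,
      Nat.add_sub_cancel, zero_add]
    match_scalars <;> ring

/-- The third relation propagates along left multiplication by `A`: this is the resolution of the
overlap ambiguity `CBA`. -/
theorem rel_apply_of_rel {V : Type*} [AddCommGroup V] [Module F V] {θ : F}
    {a b c : Module.End F V} (hab : a * b = q • (b * a) + algebraMap F _ θ)
    (hca : c * a = q • (a * c) + algebraMap F _ θ) {v : V}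
    (hv : b (c v) = q • c (b v) + θ • v) :
    b (c (a v)) = q • c (b (a v)) + θ • a v := by
  have hab' (w : V) : a (b w) = q • b (a w) + θ • w := by
    simpa using LinearMap.congr_fun hab w
  have hca' (w : V) : c (a w) = q • a (c w) + θ • w := by
    simpa using LinearMap.congr_fun hca w
  have h1 : q • c (b (a v)) = c (a (b v)) - θ • c v := by
    rw [hab' v, map_add, map_smul, map_smul, add_sub_cancel_right]
  rw [h1, hca' v, hca' (b v), map_add, map_smul, map_smul]
  have h2 : q • b (a (c v)) = a (b (c v)) - θ • c v := by
    rw [hab' (c v), add_sub_cancel_right]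
  rw [h2, hv, map_add, map_smul, map_smul]
  abel

theorem opB_mul_opC (hq : q ≠ 0) (θ : F) :
    opB q θ * opC q θ = q • (opC q θ * opB q θ) + algebraMap F _ θ := by
  refine end_ext fun i j k => ?_
  simp only [Module.End.mul_apply, LinearMap.add_apply, LinearMap.smul_apply,
    Module.algebraMap_end_apply]
  induction i with
  | zero =>
    cases j <;>
    · simp only [opB_mono, opC_mono, map_sub, map_smul, qNat, pow_succ,
        Nat.add_sub_cancel, zero_add, pow_zero, one_smul, mul_zero, zero_smul, sub_zero, add_zero]
      match_scalars <;> field_simp <;> ring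
  | succ i ih =>
    rw [← opA_mono]
    exact rel_apply_of_rel (opA_mul_opB hq θ) (opC_mul_opA θ) ih

/-- The action of the `Z3`-symmetric `q`-Weyl algebra on formal ordered monomials. -/
def rep (hq : q ≠ 0) (θ : F) : Wq3 F q θ →ₐ[F] Module.End F (Monomials F) :=
  RingQuot.liftAlgHom F ⟨FreeAlgebra.lift F ![opA F, opB q θ, opC q θ], by
    rintro _ _ (_ | _ | _)
    · simpa using opA_mul_opB hq θ
    · simpa using opB_mul_opC hq θ
    · simpa using opC_mul_opA θ⟩

theorem rep_gen (hq : q ≠ 0) (θ : F) (i : Fin 3) :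
    rep hq θ (Wq3gen F q θ i) = ![opA F, opB q θ, opC q θ] i := by
  simp [rep, Wq3gen]

theorem opC_pow_apply (q θ : F) (k : ℕ) : (opC q θ ^ k) (mono F 0 0 0) = mono F 0 0 k := by
  induction k with
  | zero => simp
  | succ k ih => rw [pow_succ', Module.End.mul_apply, ih, opC_mono]; simp [qNat]

theorem opB_pow_apply (q θ : F) (j k : ℕ) : (opB q θ ^ j) (mono F 0 0 k) = mono F 0 j k := by
  induction j with
  | zero => simp
  | succ j ih => rw [pow_succ', Module.End.mul_apply, ih, opB_mono]; simp [qNat]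

theorem opA_pow_apply (i j k : ℕ) : (opA F ^ i) (mono F 0 j k) = mono F i j k := by
  induction i with
  | zero => simp
  | succ i ih => rw [pow_succ', Module.End.mul_apply, ih, opA_mono]

theorem linearIndependent_monomials (hq : q ≠ 0) (θ : F) :
    LinearIndependent F (fun p : ℕ × ℕ × ℕ =>
      Wq3gen F q θ 0 ^ p.1 * Wq3gen F q θ 1 ^ p.2.1 * Wq3gen F q θ 2 ^ p.2.2) := by
  refine LinearIndependent.of_comp
    ((LinearMap.applyₗ (mono F 0 0 0)).comp (rep hq θ).toLinearMap) ?_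
  convert Finsupp.linearIndependent_single_one F (ℕ × ℕ × ℕ) using 1
  funext ⟨i, j, k⟩
  simp [rep_gen, opC_pow_apply, opB_pow_apply, opA_pow_apply]

end Representation

end Wq3

/-- for `q ≠ 0`, the monomials `A^i B^j C^k` (`i,j,k ∈ ℕ`) form a basis of the
Z3-symmetric q-Weyl algebra `𝕎_q(θ)`. -/
theorem stmt17 (F : Type*) [Field F] [IsAlgClosed F] [CharZero F] (q : F) (hq : q ≠ 0)
    (θ : F) :
    LinearIndependent F
        (fun p : ℕ × ℕ × ℕ =>
          Wq3gen F q θ 0 ^ p.1 * Wq3gen F q θ 1 ^ p.2.1 * Wq3gen F q θ 2 ^ p.2.2) ∧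
      Submodule.span F
        (Set.range fun p : ℕ × ℕ × ℕ =>
          Wq3gen F q θ 0 ^ p.1 * Wq3gen F q θ 1 ^ p.2.1 * Wq3gen F q θ 2 ^ p.2.2) = ⊤ :=
  ⟨Wq3.linearIndependent_monomials hq θ, Wq3.monomialSpan_gen_eq_top hq⟩
end
end

section
/- Fix a nonzero q in F. Pick theta, xi in F and define alpha = q*xi + q^{-1}, beta = -xi, gamma = (xi - q^{-1})*theta. Then there exists an algebra homomorphism from the Z3-symmetric down-up algebra A(alpha,beta,gamma) to the Z3-symmetric q-Weyl algebra W_q(theta) that sends A to A, B to B, and C to C. -/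
noncomputable section

/-- If `x * y = q • (y * x) + θ`, then `x` and `y` satisfy the down-up relation for `y * x ^ 2`. -/
theorem down_up_left_of_q_weyl {F R : Type*} [Field F] [Ring R] [Algebra F R] {q : F}
    (hq : q ≠ 0) (θ ξ : F) {x y : R} (h : x * y = q • (y * x) + algebraMap F R θ) :
    y * x ^ 2 = (q * ξ + q⁻¹) • (x * y * x) + (-ξ) • (x ^ 2 * y) + ((ξ - q⁻¹) * θ) • x := by
  have h₁ : x * y * x = q • (y * x ^ 2) + θ • x := by
    rw [h, add_mul, smul_mul_assoc, mul_assoc, ← pow_two, Algebra.smul_def θ]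
  have h₂ : x ^ 2 * y = q • (x * y * x) + θ • x := by
    rw [pow_two, mul_assoc, h, mul_add, mul_smul_comm, ← mul_assoc, ← Algebra.commutes,
      ← Algebra.smul_def, h]
  rw [h₂, h₁]
  match_scalars <;> field_simp <;> ring

/-- If `x * y = q • (y * x) + θ`, then `x` and `y` satisfy the down-up relation for `y ^ 2 * x`. -/
theorem down_up_right_of_q_weyl {F R : Type*} [Field F] [Ring R] [Algebra F R] {q : F}
    (hq : q ≠ 0) (θ ξ : F) {x y : R} (h : x * y = q • (y * x) + algebraMap F R θ) :
    y ^ 2 * x = (q * ξ + q⁻¹) • (y * x * y) + (-ξ) • (x * y ^ 2) + ((ξ - q⁻¹) * θ) • y := by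
  have h₁ : y * x * y = q • (y ^ 2 * x) + θ • y := by
    rw [mul_assoc, h, mul_add, mul_smul_comm, ← mul_assoc, ← pow_two, ← Algebra.commutes,
      ← Algebra.smul_def]
  have h₂ : x * y ^ 2 = q • (y * x * y) + θ • y := by
    rw [pow_two, ← mul_assoc, h, add_mul, smul_mul_assoc, ← Algebra.smul_def, mul_assoc]
  rw [h₂, h₁]
  match_scalars <;> field_simp <;> ring

/-- for `q ≠ 0`, with `α = qξ + q⁻¹`, `β = -ξ`, `γ = (ξ - q⁻¹)θ`, an algebra
homomorphism `𝔸(α,β,γ) → 𝕎_q(θ)` sending `A ↦ A`, `B ↦ B`, `C ↦ C`. -/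
theorem stmt18 (F : Type*) [Field F] [IsAlgClosed F] [CharZero F] (q : F) (hq : q ≠ 0)
    (θ ξ : F) :
    ∃ f : DU F (q * ξ + q⁻¹) (-ξ) ((ξ - q⁻¹) * θ) →ₐ[F] Wq3 F q θ,
      f (DUgen F (q * ξ + q⁻¹) (-ξ) ((ξ - q⁻¹) * θ) 0) = Wq3gen F q θ 0 ∧
      f (DUgen F (q * ξ + q⁻¹) (-ξ) ((ξ - q⁻¹) * θ) 1) = Wq3gen F q θ 1 ∧
      f (DUgen F (q * ξ + q⁻¹) (-ξ) ((ξ - q⁻¹) * θ) 2) = Wq3gen F q θ 2 := by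
  have h₀₁ : Wq3gen F q θ 0 * Wq3gen F q θ 1 =
      q • (Wq3gen F q θ 1 * Wq3gen F q θ 0) + algebraMap F _ θ := by
    simpa [Wq3gen] using RingQuot.mkAlgHom_rel F (Wq3Rel.r1 (F := F) (q := q) (θ := θ))
  have h₁₂ : Wq3gen F q θ 1 * Wq3gen F q θ 2 =
      q • (Wq3gen F q θ 2 * Wq3gen F q θ 1) + algebraMap F _ θ := by
    simpa [Wq3gen] using RingQuot.mkAlgHom_rel F (Wq3Rel.r2 (F := F) (q := q) (θ := θ))
  have h₂₀ : Wq3gen F q θ 2 * Wq3gen F q θ 0 =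
      q • (Wq3gen F q θ 0 * Wq3gen F q θ 2) + algebraMap F _ θ := by
    simpa [Wq3gen] using RingQuot.mkAlgHom_rel F (Wq3Rel.r3 (F := F) (q := q) (θ := θ))
  have key : ∀ ⦃a b⦄, DURel F (q * ξ + q⁻¹) (-ξ) ((ξ - q⁻¹) * θ) a b →
      FreeAlgebra.lift F (Wq3gen F q θ) a = FreeAlgebra.lift F (Wq3gen F q θ) b := by
    rintro _ _ (_ | _ | _ | _ | _ | _) <;>
      simp only [XX, map_add, map_mul, map_pow, map_smul, FreeAlgebra.lift_ι_apply]
    · exact down_up_left_of_q_weyl hq θ ξ h₀₁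
    · exact down_up_right_of_q_weyl hq θ ξ h₀₁
    · exact down_up_left_of_q_weyl hq θ ξ h₁₂
    · exact down_up_right_of_q_weyl hq θ ξ h₁₂
    · exact down_up_left_of_q_weyl hq θ ξ h₂₀
    · exact down_up_right_of_q_weyl hq θ ξ h₂₀
  refine ⟨RingQuot.liftAlgHom F ⟨FreeAlgebra.lift F (Wq3gen F q θ), key⟩, ?_, ?_, ?_⟩ <;>
    simp only [DUgen, XX, RingQuot.liftAlgHom_mkAlgHom_apply, FreeAlgebra.lift_ι_apply]
end
end

section
/- The Z3-symmetric down-up algebra A(alpha,beta,gamma) is infinite-dimensional over F and noncommutative, unless alpha = 0 and beta = 0 and gamma is nonzero. -/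
noncomputable section

/-- The elements `a, b, c` of an algebra satisfy the defining relations of `DU F α β γ`. -/
structure IsDUTriple {F R : Type*} [Field F] [Ring R] [Algebra F R] (α β γ : F) (a b c : R) :
    Prop where
  r1 : b * a ^ 2 = α • (a * b * a) + β • (a ^ 2 * b) + γ • a
  r2 : b ^ 2 * a = α • (b * a * b) + β • (a * b ^ 2) + γ • b
  r3 : c * b ^ 2 = α • (b * c * b) + β • (b ^ 2 * c) + γ • b
  r4 : c ^ 2 * b = α • (c * b * c) + β • (b * c ^ 2) + γ • c
  r5 : a * c ^ 2 = α • (c * a * c) + β • (c ^ 2 * a) + γ • c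
  r6 : a ^ 2 * c = α • (a * c * a) + β • (c * a ^ 2) + γ • a

namespace IsDUTriple

variable {F R : Type*} [Field F] [Ring R] [Algebra F R] {α β γ : F} {a b c : R}

theorem exists_algHom (h : IsDUTriple α β γ a b c) :
    ∃ f : DU F α β γ →ₐ[F] R,
      f (DUgen F α β γ 0) = a ∧ f (DUgen F α β γ 1) = b ∧ f (DUgen F α β γ 2) = c := by
  refine ⟨RingQuot.liftAlgHom F ⟨FreeAlgebra.lift F ![a, b, c], ?_⟩, ?_, ?_, ?_⟩
  · intro x y hxy
    cases hxy
    · simpa using h.r1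
    · simpa using h.r2
    · simpa using h.r3
    · simpa using h.r4
    · simpa using h.r5
    · simpa using h.r6
  all_goals simp [DUgen]

theorem exists_mul_ne (h : IsDUTriple α β γ a b c) (hab : a * b ≠ b * a) :
    ∃ x y : DU F α β γ, x * y ≠ y * x := by
  obtain ⟨f, rfl, rfl, rfl⟩ := h.exists_algHom
  exact ⟨_, _, fun hxy => hab (by rw [← map_mul, hxy, map_mul])⟩

/-- An algebra acting on a module so that some vector generates an infinite linearly independent
family is infinite-dimensional. -/
theorem not_finiteDimensional {V : Type*} [AddCommGroup V] [Module F V]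
    {a b c : Module.End F V} (h : IsDUTriple α β γ a b c) {e : ℕ → V}
    (he : LinearIndependent F e)
    (hstep : ∀ W : Submodule F V, (∀ w ∈ W, a w ∈ W) → (∀ w ∈ W, b w ∈ W) →
      (∀ w ∈ W, c w ∈ W) → ∀ n, e n ∈ W → e (n + 1) ∈ W) :
    ¬ FiniteDimensional F (DU F α β γ) := by
  intro hfin
  obtain ⟨f, rfl, rfl, rfl⟩ := h.exists_algHom
  let φ : DU F α β γ →ₗ[F] V := (LinearMap.applyₗ (e 0)).comp f.toLinearMap
  have hinv : ∀ g, ∀ w ∈ LinearMap.range φ, f g w ∈ LinearMap.range φ := by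
    rintro g _ ⟨d, rfl⟩
    exact ⟨g * d, by simp [φ]⟩
  have hmem : ∀ n, e n ∈ LinearMap.range φ := by
    intro n
    induction n with
    | zero => exact ⟨1, by simp [φ]⟩
    | succ n ih => exact hstep _ (hinv _) (hinv _) (hinv _) n ih
  have hli : LinearIndependent F (fun n => (⟨e n, hmem n⟩ : LinearMap.range φ)) :=
    LinearIndependent.of_comp (LinearMap.range φ).subtype he
  exact not_finite_iff_infinite.mpr (inferInstanceAs (Infinite ℕ)) hli.finite

/-- A triple satisfying cyclic `r`-commutation relations satisfies the down-up relations. -/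
theorem of_cyclic {r s t : F} (hba : b * a = r • (a * b) + t • (1 : R))
    (hcb : c * b = r • (b * c) + t • (1 : R)) (hac : a * c = r • (c * a) + t • (1 : R)) :
    IsDUTriple (r + s) (-(r * s)) (t * (1 - s)) a b c := by
  have key : ∀ x y : R, y * x = r • (x * y) + t • (1 : R) →
      y * x ^ 2 = (r + s) • (x * y * x) + (-(r * s)) • (x ^ 2 * y) + (t * (1 - s)) • x ∧
      y ^ 2 * x = (r + s) • (y * x * y) + (-(r * s)) • (x * y ^ 2) + (t * (1 - s)) • y := by
    intro x y h
    constructor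
    · rw [pow_two, ← mul_assoc y, mul_assoc x y x, h]
      simp only [add_mul, mul_add, smul_mul_assoc, mul_smul_comm, one_mul, mul_one]
      rw [mul_assoc x y x, h]
      simp only [mul_add, mul_smul_comm, mul_one, mul_assoc]
      module
    · rw [pow_two, mul_assoc y y x, h]
      simp only [add_mul, mul_add, smul_mul_assoc, mul_smul_comm, one_mul, mul_one]
      rw [← mul_assoc y x y, h]
      simp only [add_mul, smul_mul_assoc, one_mul, mul_assoc]
      module
  exact ⟨(key a b hba).1, (key a b hba).2, (key b c hcb).1, (key b c hcb).2,
    (key c a hac).1, (key c a hac).2⟩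

theorem of_commutator {s t : F} (hba : b * a = (1 : F) • (a * b) + t • (1 : R)) :
    IsDUTriple (1 + s) (-(1 * s)) (t * (1 - s)) a b (-a - b) := by
  apply of_cyclic hba
  · simp only [sub_mul, mul_sub, neg_mul, mul_neg, hba, one_smul]
    abel
  · simp only [sub_mul, mul_sub, neg_mul, mul_neg, hba, one_smul]
    abel

end IsDUTriple

section Representations

variable {F : Type*} [Field F]

open Polynomial

theorem linearIndependent_X_pow : LinearIndependent F (fun n : ℕ => (X : F[X]) ^ n) := by
  simpa [Polynomial.coe_basisMonomials, ← Polynomial.X_pow_eq_monomial] using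
    (Polynomial.basisMonomials F).linearIndependent

theorem du_gamma_eq_zero (α β : F) :
    ¬ FiniteDimensional F (DU F α β 0) ∧ ∃ x y : DU F α β 0, x * y ≠ y * x := by
  constructor
  · have h : IsDUTriple α β 0 (LinearMap.mulLeft F (X : F[X])) 0 0 := by
      constructor <;> simp
    refine h.not_finiteDimensional linearIndependent_X_pow ?_
    intro W ha _ _ n hn
    simpa [pow_succ'] using ha _ hn
  · have h : IsDUTriple α β 0 (Matrix.single (0 : Fin 3) (1 : Fin 3) (1 : F))
        (Matrix.single 1 2 1) 0 := by
      constructor <;> simp [pow_two]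
    refine h.exists_mul_ne ?_
    intro h
    have := congrFun (congrFun h 0) 2
    simp at this

/-- The representation through the Weyl algebra. -/
theorem du_weyl [CharZero F] (s t : F) (ht : t ≠ 0) :
    ¬ FiniteDimensional F (DU F (1 + s) (-(1 * s)) (t * (1 - s))) ∧
      ∃ x y : DU F (1 + s) (-(1 * s)) (t * (1 - s)), x * y ≠ y * x := by
  let a : Module.End F F[X] := LinearMap.mulLeft F X
  let b : Module.End F F[X] := t • derivative
  have hba : b * a = (1 : F) • (a * b) + t • 1 := by
    refine LinearMap.ext fun p => ?_
    simp [a, b, derivative_mul, add_comm]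
  have h : IsDUTriple (1 + s) (-(1 * s)) (t * (1 - s)) a b (-a - b) :=
    IsDUTriple.of_commutator hba
  refine ⟨h.not_finiteDimensional linearIndependent_X_pow ?_, h.exists_mul_ne ?_⟩
  · intro W ha _ _ n hn
    simpa [a, pow_succ'] using ha _ hn
  · intro hab
    rw [hba, one_smul, left_eq_add] at hab
    have := congrArg (fun f : Module.End F F[X] => f 1) hab
    simp [ht] at this

/-- The representation by multiples of the vector fields `x² ∂`, `(x - 1)² ∂`, `(x + 1)² ∂`,
which span `sl₂`. -/
theorem du_sl2 [CharZero F] (m : F) (hm : m ≠ 0) :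
    ¬ FiniteDimensional F (DU F 2 (-1) (8 * m ^ 2)) ∧
      ∃ x y : DU F 2 (-1) (8 * m ^ 2), x * y ≠ y * x := by
  let a : Module.End F F[X] := LinearMap.mulLeft F (4 * C m * X ^ 2) ∘ₗ derivative
  let b : Module.End F F[X] := LinearMap.mulLeft F (C m * (X - 1) ^ 2) ∘ₗ derivative
  let c : Module.End F F[X] := LinearMap.mulLeft F (C m * (X + 1) ^ 2) ∘ₗ derivative
  have h2 : (C 2 : F[X]) = 2 := map_ofNat C 2
  have h4 : (C 4 : F[X]) = 4 := map_ofNat C 4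
  have h8 : (C 8 : F[X]) = 8 := map_ofNat C 8
  have h : IsDUTriple 2 (-1) (8 * m ^ 2) a b c := by
    constructor <;> refine LinearMap.ext fun p => ?_ <;>
      simp [a, b, c, pow_two, derivative_mul, smul_eq_C_mul, h2, h8] <;> ring
  refine ⟨h.not_finiteDimensional (linearIndependent_X_pow.comp _ Nat.succ_injective) ?_,
    h.exists_mul_ne ?_⟩
  · intro W ha _ _ n hn
    have h1 := W.smul_mem (4 * m * (n + 1))⁻¹ (ha _ hn)
    convert h1 using 1
    have hne : 4 * m * ((n : F) + 1) ≠ 0 :=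
      mul_ne_zero (mul_ne_zero (by norm_num) hm) (Nat.cast_add_one_ne_zero n)
    rw [eq_inv_smul_iff₀ hne]
    simp [a, smul_eq_C_mul, h4]
    ring
  · intro hab
    have := congrArg (fun f : Module.End F F[X] => (f X).eval 2) hab
    simp [a, b, pow_two, derivative_mul] at this
    have h16 : 16 * (m * m) = 0 := by linear_combination this
    simp [hm] at h16

/-- The Verma module type representation, with diagonal middle generator. -/
theorem du_verma (r s t : F) (hr : r ≠ 0) (hr1 : r ≠ 1) :
    ¬ FiniteDimensional F (DU F (r + s) (-(r * s)) (t * (1 - s))) ∧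
      ∃ x y : DU F (r + s) (-(r * s)) (t * (1 - s)), x * y ≠ y * x := by
  have hr' : 1 - r ≠ 0 := sub_ne_zero.mpr hr1.symm
  obtain ⟨k, hk⟩ : ∃ k : F, t = k * (1 - r) := ⟨t / (1 - r), by field_simp⟩
  let e : ℕ → ℕ →₀ F := fun n => Finsupp.single n 1
  let l : ℕ → F := fun n =>
    Nat.rec 0 (fun i li => r⁻¹ * (li - t + t * k * (r ^ i)⁻¹ * (r ^ i)⁻¹)) n
  have hl : ∀ i, r * l (i + 1) = l i - t + t * k * (r ^ i)⁻¹ * (r ^ i)⁻¹ :=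
    fun i => mul_inv_cancel_left₀ hr _
  have hl0 : l 0 = 0 := rfl
  clear_value l
  let a : Module.End F (ℕ →₀ F) :=
    Finsupp.linearCombination F fun i => (k * (r ^ i)⁻¹) • e i + e (i + 1)
  let b : Module.End F (ℕ →₀ F) := Finsupp.linearCombination F fun i => r ^ i • e i
  let c : Module.End F (ℕ →₀ F) :=
    Finsupp.linearCombination F fun i => (k * (r ^ i)⁻¹) • e i + l i • e (i - 1)
  have ha : ∀ i, a (e i) = (k * (r ^ i)⁻¹) • e i + e (i + 1) := fun i => by simp [a, e]
  have hb : ∀ i, b (e i) = r ^ i • e i := fun i => by simp [b, e]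
  have hc : ∀ i, c (e i) = (k * (r ^ i)⁻¹) • e i + l i • e (i - 1) := fun i => by simp [c, e]
  have hext : ∀ f g : Module.End F (ℕ →₀ F), (∀ i, f (e i) = g (e i)) → f = g := by
    intro f g hfg
    refine Finsupp.lhom_ext' fun i => LinearMap.ext_ring ?_
    exact hfg i
  have he : LinearIndependent F e := by
    simpa [e, Finsupp.coe_basisSingleOne] using
      (Finsupp.basisSingleOne (R := F) (ι := ℕ)).linearIndependent
  clear_value a b c
  have h : IsDUTriple (r + s) (-(r * s)) (t * (1 - s)) a b c := by
    apply IsDUTriple.of_cyclic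
    · refine hext _ _ fun i => ?_
      have hp : r ^ i ≠ 0 := pow_ne_zero _ hr
      simp only [Module.End.mul_apply, LinearMap.add_apply, LinearMap.smul_apply,
        Module.End.one_apply, ha, hb, map_add, map_smul, hk]
      match_scalars <;> field_simp <;> ring
    · refine hext _ _ fun i => ?_
      have hp : r ^ i ≠ 0 := pow_ne_zero _ hr
      simp only [Module.End.mul_apply, LinearMap.add_apply, LinearMap.smul_apply,
        Module.End.one_apply, hc, hb, map_add, map_smul, hk]
      cases i with
      | zero => simp only [hl0]; module
      | succ i =>
        simp only [Nat.add_sub_cancel]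
        match_scalars <;> field_simp <;> ring
    · refine hext _ _ fun i => ?_
      have hp : r ^ i ≠ 0 := pow_ne_zero _ hr
      have hli := hl i
      simp only [Module.End.mul_apply, LinearMap.add_apply, LinearMap.smul_apply,
        Module.End.one_apply, hc, ha, map_add, map_smul, Nat.add_sub_cancel]
      cases i with
      | zero =>
        simp only [hl0] at hli ⊢
        match_scalars
        · subst hk
          simp at hli ⊢
          linear_combination -hli
        · simp; field_simp
      | succ i =>
        simp only [Nat.add_sub_cancel]
        have hq : r ^ i ≠ 0 := pow_ne_zero _ hr
        match_scalars
        · rw [hk] at hli ⊢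
          linear_combination -hli
        all_goals field_simp
        all_goals ring
  refine ⟨h.not_finiteDimensional he ?_, h.exists_mul_ne ?_⟩
  · intro W hW _ _ n hn
    have := W.sub_mem (hW _ hn) (W.smul_mem (k * (r ^ n)⁻¹) hn)
    rwa [ha, add_sub_cancel_left] at this
  · intro hab
    have := congrArg (fun f : Module.End F (ℕ →₀ F) => f (e 0)) hab
    simp only [Module.End.mul_apply, ha, hb, map_add, map_smul] at this
    have := congrArg (fun v => v 1) this
    simp [e] at this
    exact hr1 this.symm

theorem du_of_roots [CharZero F] {r s γ : F} (hr : r ≠ 0) (hs : s ≠ 1) (hγ : γ ≠ 0) :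
    ¬ FiniteDimensional F (DU F (r + s) (-(r * s)) γ) ∧
      ∃ x y : DU F (r + s) (-(r * s)) γ, x * y ≠ y * x := by
  have hs' : 1 - s ≠ 0 := sub_ne_zero.mpr hs.symm
  obtain ⟨t, rfl⟩ : ∃ t : F, γ = t * (1 - s) := ⟨γ / (1 - s), by field_simp⟩
  by_cases hr1 : r = 1
  · subst hr1
    exact du_weyl s t (left_ne_zero_of_mul hγ)
  · exact du_verma r s t hr hr1

end Representations

/-- the Z3-symmetric down-up algebra `𝔸(α,β,γ)` is infinite-dimensional over
`F` and noncommutative, unless `α = 0`, `β = 0` and `γ ≠ 0`. -/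
theorem stmt19 (F : Type*) [Field F] [IsAlgClosed F] [CharZero F] (α β γ : F)
    (h : ¬(α = 0 ∧ β = 0 ∧ γ ≠ 0)) :
    ¬ FiniteDimensional F (DU F α β γ) ∧ ∃ x y : DU F α β γ, x * y ≠ y * x := by
  by_cases hγ : γ = 0
  · subst hγ
    exact du_gamma_eq_zero α β
  obtain ⟨z, hz⟩ := IsAlgClosed.exists_pow_nat_eq (α ^ 2 + 4 * β) (n := 2) two_pos
  obtain ⟨r, s, rfl, rfl⟩ : ∃ r s : F, α = r + s ∧ β = -(r * s) :=
    ⟨(α + z) / 2, (α - z) / 2, by ring, by linear_combination -hz / 4⟩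
  by_cases h1 : r ≠ 0 ∧ s ≠ 1
  · exact du_of_roots h1.1 h1.2 hγ
  by_cases h2 : s ≠ 0 ∧ r ≠ 1
  · rw [add_comm r s, mul_comm r s]
    exact du_of_roots h2.1 h2.2 hγ
  have hrs : r = 1 ∧ s = 1 := by
    by_cases hr : r = 0
    · subst hr
      have hs : s = 0 := by simpa using h2
      simp [hs, hγ] at h
    · have hs : s = 1 := by simpa [hr] using h1
      exact ⟨by simpa [hs] using h2, hs⟩
  obtain ⟨rfl, rfl⟩ := hrs
  obtain ⟨m, hm⟩ := IsAlgClosed.exists_pow_nat_eq (γ / 8) (n := 2) two_pos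
  obtain rfl : γ = 8 * m ^ 2 := by rw [hm]; field_simp
  have hm0 : m ≠ 0 := by
    rintro rfl
    simp at hγ
  rw [one_add_one_eq_two, one_mul]
  exact du_sl2 m hm0
end
end
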